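/- Let U be an open neighbourhood of 0 in ℝ^m and let f : U → ℝ be real analytic with f(0) = 0. Then there exist an open neighbourhood V of 0 with V ⊆ U and a constant C ≥ 0 such that for all x = (x_1,…,x_m) ∈ V: |f(x)| ≤ C · (x_1² + ⋯ + x_m²)^{1/2} · ( Σ_{i=1}^{m} ((∂f/∂x_i)(x))² )^{1/2}, i.e. |f(x)| ≤ C·|x|·|∇f(x)|. -/

import Mathlib

namespace LojGrad

open Filter Topology Set

/-- averaging operator on analytic germs -/
theorem analyticAt_avg {E : Type*} [NormedAddCommGroup E] [NormedSpace ℝ E]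
    {g : E × ℝ → ℝ} (hg : AnalyticAt ℝ g 0) :
    AnalyticAt ℝ (fun p : E × ℝ => ∫ t in (0:ℝ)..1, g (p.1, t * p.2)) 0 := by
  obtain ⟨P, r, hP⟩ := hg
  let S : ℝ → (E × ℝ →L[ℝ] E × ℝ) := fun t =>
    (ContinuousLinearMap.inl ℝ E ℝ).comp (ContinuousLinearMap.fst ℝ E ℝ) +
      t • (ContinuousLinearMap.inr ℝ E ℝ).comp (ContinuousLinearMap.snd ℝ E ℝ)
  have hSa : ∀ t y, S t y = (y.1, t * y.2) := by
    intro t y; simp [S]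
  have hSc : Continuous S := by fun_prop
  have hSn : ∀ t ∈ uIoc (0:ℝ) 1, ∀ y, ‖S t y‖ ≤ ‖y‖ := by
    intro t ht y
    rw [uIoc_of_le zero_le_one] at ht
    rw [hSa, Prod.norm_def, Prod.norm_def]
    refine max_le_max le_rfl ?_
    rw [norm_mul]
    have : ‖t‖ ≤ 1 := by rw [Real.norm_eq_abs, abs_le]; constructor <;> linarith [ht.1, ht.2]
    nlinarith [norm_nonneg y.2]
  have hSn1 : ∀ t ∈ uIoc (0:ℝ) 1, ‖S t‖ ≤ 1 := fun t ht =>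
    ContinuousLinearMap.opNorm_le_bound _ zero_le_one (by simpa using hSn t ht)
  let K : (n : ℕ) → ℝ → ContinuousMultilinearMap ℝ (fun _ : Fin n => E × ℝ) ℝ := fun n t =>
    (P n).compContinuousLinearMap (fun _ => S t)
  have hKc : ∀ n, Continuous (K n) := by
    intro n
    have : K n = fun t => (ContinuousMultilinearMap.compContinuousLinearMapContinuousMultilinear
      ℝ (fun _ : Fin n => E × ℝ) (fun _ : Fin n => E × ℝ) ℝ (fun _ => S t)) (P n) := by
      funext t; rfl
    rw [this]
    have h2 : Continuous fun t => (ContinuousMultilinearMap.compContinuousLinearMapContinuousMultilinear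
      ℝ (fun _ : Fin n => E × ℝ) (fun _ : Fin n => E × ℝ) ℝ) (fun _ => S t) :=
      (ContinuousMultilinearMap.cont _).comp (continuous_pi fun _ => hSc)
    exact h2.clm_apply continuous_const
  have hKn : ∀ n, ∀ t ∈ uIoc (0:ℝ) 1, ‖K n t‖ ≤ ‖P n‖ := by
    intro n t ht
    refine (ContinuousMultilinearMap.norm_compContinuousLinearMap_le _ _).trans ?_
    refine mul_le_of_le_one_right (norm_nonneg _) ?_
    exact Finset.prod_le_one (fun _ _ => norm_nonneg _) (fun _ _ => hSn1 t ht)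
  let Q : FormalMultilinearSeries ℝ (E × ℝ) ℝ := fun n => ∫ t in (0:ℝ)..1, K n t
  have hQn : ∀ n, ‖Q n‖ ≤ ‖P n‖ := by
    intro n
    have := intervalIntegral.norm_integral_le_of_norm_le_const (hKn n)
    simpa using this
  refine ⟨Q, r, ?_, hP.r_pos, ?_⟩
  · refine hP.r_le.trans ?_
    refine ENNReal.le_of_forall_nnreal_lt fun ρ hρ => ?_
    obtain ⟨C, _, hC⟩ := P.norm_mul_pow_le_of_lt_radius hρ
    refine Q.le_radius_of_bound C fun n => ?_
    exact (mul_le_mul_of_nonneg_right (hQn n) (by positivity)).trans (hC n)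
  · intro y hy
    have e1 : ∀ n, (Q n fun _ => y) = ∫ t in (0:ℝ)..1, (P n fun _ => S t y) := by
      intro n
      have h1 := (ContinuousMultilinearMap.apply ℝ (fun _ : Fin n => E × ℝ) ℝ
        (fun _ => y)).intervalIntegral_comp_comm ((hKc n).intervalIntegrable (μ := MeasureTheory.volume) 0 1)
      exact h1.symm
    simp only [e1, zero_add]
    have hyr : y ∈ Metric.eball (0 : E × ℝ) P.radius := Metric.eball_subset_eball hP.r_le hy
    refine intervalIntegral.hasSum_integral_of_dominated_convergence
      (fun n _ => ‖P n‖ * ‖y‖ ^ n) ?_ ?_ ?_ ?_ ?_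
    · intro n
      refine Continuous.aestronglyMeasurable ?_
      refine (P n).cont.comp (continuous_pi fun _ => ?_)
      fun_prop
    · intro n
      refine Filter.Eventually.of_forall fun t ht => ?_
      refine ((P n).le_opNorm _).trans ?_
      refine mul_le_mul_of_nonneg_left ?_ (norm_nonneg _)
      simpa using pow_le_pow_left₀ (norm_nonneg _) (hSn t ht y) n
    · refine Filter.Eventually.of_forall fun t ht => ?_
      have : ((‖y‖₊ : NNReal) : ENNReal) < P.radius := by
        simpa [edist_zero_right, enorm] using hyr
      simpa using P.summable_norm_mul_pow this
    · simp
    · refine Filter.Eventually.of_forall fun t ht => ?_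
      have hs : S t y ∈ Metric.eball (0 : E × ℝ) r := by
        simp only [Metric.mem_eball, edist_zero_right] at hy ⊢
        refine lt_of_le_of_lt ?_ hy
        exact enorm_le_iff_norm_le.mpr (hSn t ht y)
      have := hP.hasSum hs
      rw [zero_add, hSa] at this
      simpa only [hSa] using this

/-- Hadamard division for analytic germs -/
theorem hadamard {E : Type*} [NormedAddCommGroup E] [NormedSpace ℝ E]
    {f : E × ℝ → ℝ} (hf : AnalyticAt ℝ f 0) :
    ∃ q : E × ℝ → ℝ, AnalyticAt ℝ q 0 ∧
      ∀ᶠ p in 𝓝 (0 : E × ℝ), f p = f (p.1, 0) + p.2 * q p := by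
  let g : E × ℝ → ℝ := fun p => fderiv ℝ f p (0, 1)
  have hg : AnalyticAt ℝ g 0 := by
    have := hf.fderiv
    exact (ContinuousLinearMap.analyticAt (ContinuousLinearMap.apply ℝ ℝ ((0, 1) : E × ℝ)) _).comp this
  refine ⟨_, analyticAt_avg hg, ?_⟩
  obtain ⟨ε, hε, hball⟩ := Metric.eventually_nhds_iff_ball.1 hf.eventually_analyticAt
  filter_upwards [Metric.ball_mem_nhds (0 : E × ℝ) hε] with p hp
  have hmem : ∀ t ∈ uIcc (0:ℝ) 1, ((p.1, t * p.2) : E × ℝ) ∈ Metric.ball (0 : E × ℝ) ε := by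
    intro t ht
    rw [uIcc_of_le zero_le_one] at ht
    rw [mem_ball_zero_iff] at hp ⊢
    refine lt_of_le_of_lt ?_ hp
    rw [Prod.norm_def, Prod.norm_def]
    refine max_le_max le_rfl ?_
    rw [norm_mul]
    have : ‖t‖ ≤ 1 := by rw [Real.norm_eq_abs, abs_le]; constructor <;> linarith [ht.1, ht.2]
    have := norm_nonneg p.2
    nlinarith
  have hpath : ∀ t, HasDerivAt (fun t : ℝ => ((p.1, t * p.2) : E × ℝ)) (0, p.2) t := by
    intro t
    refine (hasDerivAt_const t p.1).prodMk ?_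
    simpa using (hasDerivAt_id t).mul_const p.2
  have hd : ∀ t ∈ uIcc (0:ℝ) 1,
      HasDerivAt (fun t : ℝ => f (p.1, t * p.2)) (p.2 * g (p.1, t * p.2)) t := by
    intro t ht
    have h1 := (hball _ (hmem t ht)).differentiableAt.hasFDerivAt.comp_hasDerivAt t (hpath t)
    have : ((0, p.2) : E × ℝ) = p.2 • ((0, 1) : E × ℝ) := by simp
    rw [this, map_smul] at h1
    exact h1
  have hcont : ContinuousOn (fun t : ℝ => p.2 * g (p.1, t * p.2)) (uIcc 0 1) := by
    refine continuousOn_const.mul ?_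
    intro t ht
    refine ContinuousAt.continuousWithinAt ?_
    have h2 : ContinuousAt g (p.1, t * p.2) := by
      have := (hball _ (hmem t ht)).fderiv.continuousAt
      exact this.clm_apply continuousAt_const
    exact ContinuousAt.comp (f := fun t : ℝ => ((p.1, t * p.2) : E × ℝ)) h2 (hpath t).continuousAt
  have := intervalIntegral.integral_eq_sub_of_hasDerivAt hd hcont.intervalIntegrable
  rw [intervalIntegral.integral_const_mul] at this
  simp only [one_mul, zero_mul] at this
  linarith

theorem expansion {E : Type*} [NormedAddCommGroup E] [NormedSpace ℝ E]
    {f : E × ℝ → ℝ} (hf : AnalyticAt ℝ f 0) (n : ℕ) :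
    ∃ (a : ℕ → E → ℝ) (h : E × ℝ → ℝ), (∀ i, AnalyticAt ℝ (a i) 0) ∧ AnalyticAt ℝ h 0 ∧
      ∀ᶠ p in 𝓝 (0 : E × ℝ), f p = ∑ i ∈ Finset.range n, a i p.1 * p.2 ^ i + p.2 ^ n * h p := by
  induction n with
  | zero => exact ⟨fun _ _ => 0, f, fun _ => analyticAt_const, hf, by simp⟩
  | succ n ih =>
    obtain ⟨a, h, ha, hh, e⟩ := ih
    obtain ⟨q, hq, e2⟩ := hadamard hh
    have ha' : AnalyticAt ℝ (fun y : E => h (y, 0)) 0 :=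
      AnalyticAt.comp (f := fun y : E => ((y, 0) : E × ℝ)) hh (by fun_prop)
    refine ⟨Function.update a n (fun y => h (y, 0)), q, ?_, hq, ?_⟩
    · intro i
      by_cases hi : i = n
      · subst hi; simpa using ha'
      · simpa [Function.update_of_ne hi] using ha i
    · filter_upwards [e, e2] with p h1 h2
      rw [h1, Finset.sum_range_succ, h2]
      have : ∑ i ∈ Finset.range n, Function.update a n (fun y => h (y, 0)) i p.1 * p.2 ^ i
          = ∑ i ∈ Finset.range n, a i p.1 * p.2 ^ i := by
        refine Finset.sum_congr rfl fun i hi => ?_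
        rw [Function.update_of_ne (by have := Finset.mem_range.1 hi; omega)]
      rw [this, Function.update_self]
      ring

end LojGrad

namespace LojGrad

open Filter Topology Set

@[fun_prop]
theorem an_fst {A B C : Type*} [NormedAddCommGroup A] [NormedSpace ℝ A] [NormedAddCommGroup B]
    [NormedSpace ℝ B] [NormedAddCommGroup C] [NormedSpace ℝ C] {f : A → B × C} {x : A}
    (hf : AnalyticAt ℝ f x) : AnalyticAt ℝ (fun y => (f y).1) x :=
  AnalyticAt.comp (f := f) analyticAt_fst hf

@[fun_prop]
theorem an_snd {A B C : Type*} [NormedAddCommGroup A] [NormedSpace ℝ A] [NormedAddCommGroup B]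
    [NormedSpace ℝ B] [NormedAddCommGroup C] [NormedSpace ℝ C] {f : A → B × C} {x : A}
    (hf : AnalyticAt ℝ f x) : AnalyticAt ℝ (fun y => (f y).2) x :=
  AnalyticAt.comp (f := f) analyticAt_snd hf

theorem onevar (D : ℕ) : ∀ (c : ℕ → ℝ) (k u : ℝ → ℝ), ContinuousAt k 0 → ContinuousAt u 0 →
    (∀ᶠ t in 𝓝[≠] (0:ℝ), ∑ i ∈ Finset.range D, c i * t ^ i + t ^ D * k t = t ^ D * u t) →
    (∀ i < D, c i = 0) ∧ k 0 = u 0 := by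
  induction D with
  | zero =>
    intro c k u hk hu h
    refine ⟨by simp, ?_⟩
    have h1 : Tendsto k (𝓝[≠] 0) (𝓝 (k 0)) := hk.tendsto.mono_left nhdsWithin_le_nhds
    have h2 : Tendsto u (𝓝[≠] 0) (𝓝 (u 0)) := hu.tendsto.mono_left nhdsWithin_le_nhds
    refine tendsto_nhds_unique_of_eventuallyEq h1 h2 ?_
    filter_upwards [h] with t ht
    simpa using ht
  | succ D ih =>
    intro c k u hk hu h
    have hc0 : c 0 = 0 := by
      have h1 : ContinuousAt (fun t : ℝ => ∑ i ∈ Finset.range (D + 1), c i * t ^ i + t ^ (D + 1) * k t) 0 := by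
        fun_prop
      have h2 : ContinuousAt (fun t : ℝ => t ^ (D + 1) * u t) 0 := by fun_prop
      have := tendsto_nhds_unique_of_eventuallyEq
        (h1.tendsto.mono_left nhdsWithin_le_nhds) (h2.tendsto.mono_left nhdsWithin_le_nhds) h
      simpa [Finset.sum_range_succ'] using this
    obtain ⟨h1, h2⟩ := ih (fun i => c (i + 1)) k u hk hu (by
      filter_upwards [h, self_mem_nhdsWithin] with t ht ht0
      have ht0 : t ≠ 0 := ht0
      rw [Finset.sum_range_succ', hc0] at ht
      have e : ∑ i ∈ Finset.range D, c (i + 1) * t ^ (i + 1) =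
          t * ∑ i ∈ Finset.range D, c (i + 1) * t ^ i := by
        rw [Finset.mul_sum]; exact Finset.sum_congr rfl fun i _ => by ring
      rw [e] at ht
      apply mul_left_cancel₀ ht0
      rw [pow_succ] at ht
      linear_combination ht)
    refine ⟨?_, h2⟩
    intro i hi
    cases i with
    | zero => exact hc0
    | succ i => exact h1 i (by omega)

/-- order exactly `D` in the last variable -/
def Reg {E : Type*} [Zero E] (f : E × ℝ → ℝ) (D : ℕ) : Prop :=
  ∃ u : ℝ → ℝ, AnalyticAt ℝ u 0 ∧ u 0 ≠ 0 ∧ ∀ᶠ t in 𝓝 (0:ℝ), f (0, t) = t ^ D * u t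

variable {E : Type*} [NormedAddCommGroup E] [NormedSpace ℝ E]

theorem tendsto_line {E : Type*} [NormedAddCommGroup E] : Tendsto (fun t : ℝ => ((0, t) : E × ℝ)) (𝓝 0) (𝓝 0) := by
  have : Continuous (fun t : ℝ => ((0, t) : E × ℝ)) := by fun_prop
  exact this.tendsto' 0 0 rfl

theorem reg_coeffs {f : E × ℝ → ℝ} {D : ℕ} (hr : Reg f D) {a : ℕ → E → ℝ} {h : E × ℝ → ℝ}
    (hh : AnalyticAt ℝ h 0)
    (e : ∀ᶠ p in 𝓝 (0 : E × ℝ), f p = ∑ i ∈ Finset.range D, a i p.1 * p.2 ^ i + p.2 ^ D * h p) :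
    (∀ i < D, a i 0 = 0) ∧ h 0 ≠ 0 := by
  obtain ⟨u, hu, hu0, hfu⟩ := hr
  have e2 := tendsto_line.eventually e
  have := onevar D (fun i => a i 0) (fun t => h (0, t)) u
    (ContinuousAt.comp (f := fun t : ℝ => ((0, t) : E × ℝ)) (x := 0) hh.continuousAt (by fun_prop))
    hu.continuousAt (by
      refine Filter.Eventually.filter_mono nhdsWithin_le_nhds ?_
      filter_upwards [e2, hfu] with t h1 h2
      rw [← h2, h1])
  refine ⟨this.1, ?_⟩
  have h2 : h ((0:E), (0:ℝ)) = u 0 := this.2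
  change h ((0:E), (0:ℝ)) ≠ 0
  rwa [h2]

theorem invertible_real (L : ℝ →L[ℝ] ℝ) (hL : L 1 ≠ 0) : L.IsInvertible := by
  refine ⟨ContinuousLinearEquiv.unitsEquivAut ℝ (Units.mk0 (L 1) hL), ?_⟩
  ext
  simp

theorem tschirnhaus [CompleteSpace E] {f : E × ℝ → ℝ} (hf : AnalyticAt ℝ f 0) (n : ℕ)
    (hr : Reg f (n + 1)) :
    ∃ φ : E → ℝ, AnalyticAt ℝ φ 0 ∧ φ 0 = 0 ∧
    ∃ (a : ℕ → E → ℝ) (h : E × ℝ → ℝ), (∀ i, AnalyticAt ℝ (a i) 0) ∧ AnalyticAt ℝ h 0 ∧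
      (∀ᶠ p in 𝓝 (0 : E × ℝ), f (p.1, p.2 + φ p.1) =
        ∑ i ∈ Finset.range (n + 1), a i p.1 * p.2 ^ i + p.2 ^ (n + 1) * h p) ∧
      ∀ᶠ y in 𝓝 (0 : E), a n y = 0 := by
  let F : (E × ℝ) × ℝ → ℝ := fun q => f (q.1.1, q.1.2 + q.2)
  have hF : AnalyticAt ℝ F 0 :=
    AnalyticAt.comp_of_eq (f := fun q : (E × ℝ) × ℝ => ((q.1.1, q.1.2 + q.2) : E × ℝ)) hf
      (by fun_prop) (by simp)
  obtain ⟨A, H, hA, hH, e⟩ := expansion hF (n + 1)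
  let φ0 : ℝ → ℝ := fun t => f (0, t)
  have hφ0 : AnalyticAt ℝ φ0 0 :=
    AnalyticAt.comp (f := fun t : ℝ => ((0, t) : E × ℝ)) hf (by fun_prop)
  have key : ∀ᶠ w in 𝓝 (0:ℝ), ∀ i < n + 1, A i (0, w) = iteratedDeriv i φ0 w / i.factorial := by
    have t1 : Tendsto (fun w : ℝ => ((((0:E), w), (0:ℝ)) : (E × ℝ) × ℝ)) (𝓝 0) (𝓝 0) := by
      have : Continuous (fun w : ℝ => ((((0:E), w), (0:ℝ)) : (E × ℝ) × ℝ)) := by fun_prop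
      exact this.tendsto' 0 0 rfl
    filter_upwards [t1.eventually e.eventually_nhds, t1.eventually hH.eventually_analyticAt,
      hφ0.eventually_analyticAt] with w h1 h2 h3
    have hψ : AnalyticAt ℝ (fun z => φ0 (w + z)) 0 :=
      AnalyticAt.comp_of_eq (f := fun z : ℝ => w + z) h3 (by fun_prop) (by simp)
    obtain ⟨G, hG, eG⟩ := hψ.exists_eventuallyEq_sum_add_pow_mul (n + 1)
    have cz : Continuous (fun z : ℝ => ((((0:E), w), z) : (E × ℝ) × ℝ)) := by fun_prop
    have t2 : Tendsto (fun z : ℝ => ((((0:E), w), z) : (E × ℝ) × ℝ)) (𝓝 0)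
        (𝓝 (((0:E), w), (0:ℝ))) := cz.tendsto' _ _ rfl
    have := onevar (n + 1) (fun i => A i (0, w) - iteratedDeriv i φ0 w / i.factorial)
      (fun z => H (((0:E), w), z)) G
      (ContinuousAt.comp (f := fun z : ℝ => ((((0:E), w), z) : (E × ℝ) × ℝ)) (x := 0)
        h2.continuousAt cz.continuousAt) hG.continuousAt (by
        refine Filter.Eventually.filter_mono nhdsWithin_le_nhds ?_
        filter_upwards [eG, t2.eventually h1] with z e1 e2
        have e3 : φ0 (w + z) = F (((0:E), w), z) := rfl
        rw [e3, e2] at e1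
        simp only [smul_eq_mul, iteratedDeriv_comp_const_add, add_zero] at e1
        have e4 : ∑ i ∈ Finset.range (n + 1), (A i (0, w) - iteratedDeriv i φ0 w / i.factorial) * z ^ i
          = ∑ i ∈ Finset.range (n + 1), A i (0, w) * z ^ i -
            ∑ i ∈ Finset.range (n + 1), z ^ i / i.factorial * iteratedDeriv i φ0 w := by
          rw [← Finset.sum_sub_distrib]
          exact Finset.sum_congr rfl fun i _ => by ring
        rw [e4]
        linarith)
    intro i hi
    have := this.1 i hi
    linarith
  obtain ⟨u, hu, hu0, hfu⟩ := hr
  have hord : analyticOrderAt φ0 0 = ((n + 1 : ℕ) : ℕ∞) := by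
    rw [hφ0.analyticOrderAt_eq_natCast]
    exact ⟨u, hu, hu0, by filter_upwards [hfu] with t ht; simpa [φ0] using ht⟩
  rw [analyticOrderAt_eq_nat_iff_iteratedDeriv_eq_zero hφ0] at hord
  have hA0 : A n 0 = 0 := by
    have := key.self_of_nhds n (by omega)
    rw [hord.1 n (by omega)] at this
    simp only [zero_div] at this
    exact this
  have hder : deriv (fun w => A n (0, w)) 0 ≠ 0 := by
    have h1 : (fun w => A n (0, w)) =ᶠ[𝓝 0] fun w => iteratedDeriv n φ0 w / n.factorial := by
      filter_upwards [key] with w hw using hw n (by omega)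
    rw [h1.deriv_eq, deriv_div_const, ← iteratedDeriv_succ]
    exact div_ne_zero hord.2 (by positivity)
  have hcd : ContDiffAt ℝ ⊤ (A n) 0 := (hA n).contDiffAt
  have hinv : (fderiv ℝ (A n) 0 ∘L .inr ℝ E ℝ).IsInvertible := by
    apply invertible_real
    have h1 : HasFDerivAt (A n) (fderiv ℝ (A n) 0) ((0:E), (0:ℝ)) :=
      (hA n).differentiableAt.hasFDerivAt
    have h2 : HasDerivAt (fun w : ℝ => (((0:E), w) : E × ℝ)) ((0:E), (1:ℝ)) 0 :=
      (hasDerivAt_const _ _).prodMk (hasDerivAt_id _)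
    have h3 := (h1.comp_hasDerivAt (0:ℝ) h2).deriv
    intro h0
    apply hder
    refine Eq.trans h3 ?_
    simpa using h0
  let φ := hcd.implicitFunction (by simp) hinv
  have hφ : AnalyticAt ℝ φ 0 := (hcd.contDiffAt_implicitFunction (by simp) hinv).analyticAt
  have hφz : φ 0 = 0 := hcd.implicitFunction_apply_self (by simp) hinv
  have hz : ∀ᶠ y in 𝓝 (0 : E), A n (y, φ y) = 0 := by
    have := hcd.eventually_apply_implicitFunction (by simp) hinv
    rw [hA0] at this
    exact this
  refine ⟨φ, hφ, hφz, fun i y => A i (y, φ y), fun p => H ((p.1, φ p.1), p.2), ?_, ?_, ?_, hz⟩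
  · intro i
    exact AnalyticAt.comp_of_eq (f := fun y : E => ((y, φ y) : E × ℝ)) (hA i)
      (by fun_prop) (by simp only [Prod.fst_zero, Prod.snd_zero, hφz]; rfl)
  · have hφ1 : AnalyticAt ℝ (fun p : E × ℝ => φ p.1) 0 :=
      AnalyticAt.comp_of_eq (f := fun p : E × ℝ => p.1) hφ (by fun_prop) (by simp)
    exact AnalyticAt.comp_of_eq (f := fun p : E × ℝ => (((p.1, φ p.1), p.2) : (E × ℝ) × ℝ)) hH
      (by fun_prop) (by simp only [Prod.fst_zero, Prod.snd_zero, hφz]; rfl)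
  · have hφ1 : AnalyticAt ℝ (fun p : E × ℝ => φ p.1) 0 :=
      AnalyticAt.comp_of_eq (f := fun p : E × ℝ => p.1) hφ (by fun_prop) (by simp)
    have t : Tendsto (fun p : E × ℝ => (((p.1, φ p.1), p.2) : (E × ℝ) × ℝ)) (𝓝 0) (𝓝 0) := by
      have : AnalyticAt ℝ (fun p : E × ℝ => (((p.1, φ p.1), p.2) : (E × ℝ) × ℝ)) 0 := by fun_prop
      have := this.continuousAt.tendsto
      simp only [Prod.fst_zero, Prod.snd_zero, hφz] at this
      exact this
    filter_upwards [t.eventually e] with p hp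
    rw [← hp]
    simp [F, add_comm]

end LojGrad

namespace LojGrad

open Filter Topology Set

section Mon
variable {E : Type*} [NormedAddCommGroup E] [NormedSpace ℝ E]
  {E' : Type*} [NormedAddCommGroup E'] [NormedSpace ℝ E']
  {E'' : Type*} [NormedAddCommGroup E''] [NormedSpace ℝ E'']
  {σ : Type*} [Fintype σ] {σ' : Type*} [Fintype σ']

/-- monomial times unit, relative to a coordinate family `c` -/
def Mon (c : σ → E → ℝ) (f : E → ℝ) : Prop :=
  ∃ (α : σ → ℕ) (h : E → ℝ), AnalyticAt ℝ h 0 ∧ h 0 ≠ 0 ∧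
    f =ᶠ[𝓝 0] fun x => (∏ i, c i x ^ α i) * h x

theorem Mon.unit (c : σ → E → ℝ) {h : E → ℝ} (hh : AnalyticAt ℝ h 0) (h0 : h 0 ≠ 0) : Mon c h :=
  ⟨fun _ => 0, h, hh, h0, by simp⟩

theorem Mon.coord (c : σ → E → ℝ) (i : σ) : Mon c (fun x => c i x) := by
  classical
  refine ⟨Pi.single i 1, fun _ => 1, analyticAt_const, one_ne_zero, ?_⟩
  refine Eventually.of_forall fun x => ?_
  simp only [mul_one]
  rw [Finset.prod_eq_single i]
  · simp
  · intro j _ hj; simp [hj]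
  · simp

theorem Mon.congr {c : σ → E → ℝ} {f g : E → ℝ} (hf : Mon c f) (h : g =ᶠ[𝓝 0] f) : Mon c g := by
  obtain ⟨α, k, h1, h2, h3⟩ := hf
  exact ⟨α, k, h1, h2, h.trans h3⟩

theorem Mon.mul {c : σ → E → ℝ} {f g : E → ℝ} (hf : Mon c f) (hg : Mon c g) :
    Mon c (fun x => f x * g x) := by
  obtain ⟨α, k, h1, h2, h3⟩ := hf
  obtain ⟨β, l, k1, k2, k3⟩ := hg
  refine ⟨α + β, fun x => k x * l x, h1.mul k1, mul_ne_zero h2 k2, ?_⟩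
  filter_upwards [h3, k3] with x hx hx'
  rw [hx, hx']
  simp only [Pi.add_apply, pow_add, Finset.prod_mul_distrib]
  ring

theorem Mon.one (c : σ → E → ℝ) : Mon c (fun _ => 1) := Mon.unit c analyticAt_const one_ne_zero

theorem Mon.pow {c : σ → E → ℝ} {f : E → ℝ} (hf : Mon c f) (n : ℕ) :
    Mon c (fun x => f x ^ n) := by
  induction n with
  | zero => simpa using Mon.one c
  | succ n ih => simpa only [pow_succ] using ih.mul hf

theorem Mon.prod {c : σ → E → ℝ} {ι : Type*} (s : Finset ι) {f : ι → E → ℝ}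
    (hf : ∀ i ∈ s, Mon c (f i)) : Mon c (fun x => ∏ i ∈ s, f i x) := by
  classical
  induction s using Finset.induction_on with
  | empty => simpa using Mon.one c
  | insert a s ha ih =>
    simp only [Finset.prod_insert ha]
    exact (hf a (by simp)).mul (ih fun i hi => hf i (by simp [hi]))

theorem tendsto_of_an {π : E' → E} (hπ : AnalyticAt ℝ π 0) (h0 : π 0 = 0) :
    Tendsto π (𝓝 0) (𝓝 0) := by
  have := hπ.continuousAt.tendsto; rwa [h0] at this

theorem Mon.comp {c : σ → E → ℝ} {c' : σ' → E' → ℝ} {f : E → ℝ} (hf : Mon c f) {π : E' → E}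
    (hπ : AnalyticAt ℝ π 0) (h0 : π 0 = 0) (hc : ∀ i, Mon c' (fun x => c i (π x))) :
    Mon c' (fun x => f (π x)) := by
  obtain ⟨α, k, h1, h2, h3⟩ := hf
  have h4 : Mon c' (fun x => (∏ i, c i (π x) ^ α i) * k (π x)) := by
    refine (Mon.prod _ fun i _ => (hc i).pow (α i)).mul (Mon.unit _ ?_ (by rwa [h0]))
    exact AnalyticAt.comp_of_eq h1 hπ h0
  exact h4.congr ((tendsto_of_an hπ h0).eventually h3)

/-- zero germ or monomial times unit -/
def MonZ (c : σ → E → ℝ) (f : E → ℝ) : Prop := f =ᶠ[𝓝 0] 0 ∨ Mon c f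

theorem MonZ.comp {c : σ → E → ℝ} {c' : σ' → E' → ℝ} {f : E → ℝ} (hf : MonZ c f) {π : E' → E}
    (hπ : AnalyticAt ℝ π 0) (h0 : π 0 = 0) (hc : ∀ i, Mon c' (fun x => c i (π x))) :
    MonZ c' (fun x => f (π x)) := by
  rcases hf with hf | hf
  · exact Or.inl ((tendsto_of_an hπ h0).eventually hf)
  · exact Or.inr (hf.comp hπ h0 hc)

theorem MonZ.congr {c : σ → E → ℝ} {f g : E → ℝ} (hf : MonZ c f) (h : g =ᶠ[𝓝 0] f) :
    MonZ c g := by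
  rcases hf with hf | hf
  · exact Or.inl (h.trans hf)
  · exact Or.inr (hf.congr h)

theorem MonZ.mul {c : σ → E → ℝ} {f g : E → ℝ} (hf : MonZ c f) (hg : MonZ c g) :
    MonZ c (fun x => f x * g x) := by
  rcases hf with hf | hf
  · left; filter_upwards [hf] with x hx; simp [hx]
  rcases hg with hg | hg
  · left; filter_upwards [hg] with x hx; simp [hx]
  exact Or.inr (hf.mul hg)

theorem MonZ.pow {c : σ → E → ℝ} {f : E → ℝ} (hf : MonZ c f) (n : ℕ) :
    MonZ c (fun x => f x ^ n) := by
  induction n with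
  | zero => right; simpa using Mon.one c
  | succ n ih => simpa only [pow_succ] using ih.mul hf

variable {ι : Type*}

/-- a point sequence `y` is lifted to `u` along the analytic map germ `π` -/
structure Ref (U : Ultrafilter ι) (y : ι → E) (π : E' → E) (u : ι → E') : Prop where
  an : AnalyticAt ℝ π 0
  zero : π 0 = 0
  tends : Tendsto u U (𝓝 0)
  eq : ∀ᶠ n in (U : Filter ι), y n = π (u n)

theorem Ref.comp {U : Ultrafilter ι} {y : ι → E} {π : E' → E} {u : ι → E'} {π' : E'' → E'}
    {u' : ι → E''} (h : Ref U y π u) (h' : Ref U u π' u') : Ref U y (fun x => π (π' x)) u' where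
  an := AnalyticAt.comp_of_eq h.an h'.an h'.zero
  zero := by rw [h'.zero, h.zero]
  tends := h'.tends
  eq := by filter_upwards [h.eq, h'.eq] with n h1 h2; rw [h1, h2]

/-- dichotomy for two real sequences along an ultrafilter -/
theorem dichotomy (U : Ultrafilter ι) (a b : ι → ℝ) :
    (∃ (w : ι → ℝ) (w0 : ℝ), Tendsto w U (𝓝 w0) ∧ ∀ᶠ n in (U : Filter ι), a n = b n * w n) ∨
    ((∀ᶠ n in (U : Filter ι), a n ≠ 0) ∧ Tendsto (fun n => b n / a n) U (𝓝 0)) := by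
  by_cases h : ∃ M : ℝ, ∀ᶠ n in (U : Filter ι), |a n| ≤ M * |b n|
  · left
    obtain ⟨M, hM⟩ := h
    have hb : ∀ᶠ n in (U : Filter ι), a n / b n ∈ Icc (-|M|) (|M|) := by
      filter_upwards [hM] with n hn
      rw [mem_Icc, ← abs_le, abs_div]
      refine div_le_of_le_mul₀ (abs_nonneg _) (abs_nonneg _) (hn.trans ?_)
      exact mul_le_mul_of_nonneg_right (le_abs_self M) (abs_nonneg _)
    have h2 : ((U.map (fun n => a n / b n) : Ultrafilter ℝ) : Filter ℝ) ≤ 𝓟 (Icc (-|M|) (|M|)) := by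
      rw [le_principal_iff]; exact hb
    obtain ⟨w0, _, hw0⟩ := (isCompact_Icc (a := -|M|) (b := |M|)).ultrafilter_le_nhds _ h2
    refine ⟨fun n => a n / b n, w0, hw0, ?_⟩
    filter_upwards [hM] with n hn
    by_cases hbn : b n = 0
    · simp only [hbn, abs_zero, mul_zero] at hn
      have : a n = 0 := by simpa using hn
      simp [this]
    · field_simp
  · right
    push Not at h
    have h' : ∀ M : ℝ, ∀ᶠ n in (U : Filter ι), M * |b n| < |a n| := h
    constructor
    · filter_upwards [h' 0] with n hn
      simpa using hn
    · rw [Metric.tendsto_nhds]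
      intro ε hε
      filter_upwards [h' (1 / ε), h' 0] with n hn hn0
      have hn0 : 0 < |a n| := by simpa using hn0
      rw [dist_zero_right, Real.norm_eq_abs, abs_div, div_lt_iff₀ hn0]
      have : ε * (1 / ε * |b n|) < ε * |a n| := mul_lt_mul_of_pos_left hn hε
      rwa [← mul_assoc, mul_one_div_cancel hε.ne', one_mul] at this

end Mon

/-- coordinates on `ℝ^m` -/
def cF (m : ℕ) : Fin m → (Fin m → ℝ) → ℝ := fun i x => x i

/-- coordinates on `ℝ^m × ℝ` -/
def cP (m : ℕ) : Option (Fin m) → ((Fin m → ℝ) × ℝ) → ℝ := fun o p => o.elim p.2 p.1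

/-- monomial given by a list of indices -/
def mono {m : ℕ} (l : List (Fin m)) (s : Fin m → ℝ) : ℝ := (l.map s).prod

theorem mono_cons {m : ℕ} (i : Fin m) (l : List (Fin m)) (s : Fin m → ℝ) :
    mono (i :: l) s = s i * mono l s := by simp [mono]

@[fun_prop]
theorem an_app {m : ℕ} (i : Fin m) (x : Fin m → ℝ) :
    AnalyticAt ℝ (fun f : Fin m → ℝ => f i) x :=
  (ContinuousLinearMap.proj (R := ℝ) (φ := fun _ : Fin m => ℝ) i).analyticAt x

theorem an_apply {m : ℕ} {A : Type*} [NormedAddCommGroup A] [NormedSpace ℝ A]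
    {f : A → Fin m → ℝ} {x : A} (hf : AnalyticAt ℝ f x) (i : Fin m) :
    AnalyticAt ℝ (fun y => f y i) x :=
  (analyticAt_pi_iff.1 hf) i

theorem an_pi {m : ℕ} {A : Type*} [NormedAddCommGroup A] [NormedSpace ℝ A]
    {f : A → Fin m → ℝ} {x : A} (hf : ∀ i, AnalyticAt ℝ (fun y => f y i) x) :
    AnalyticAt ℝ f x := analyticAt_pi_iff.2 hf

@[fun_prop]
theorem an_mono {m : ℕ} (l : List (Fin m)) {A : Type*} [NormedAddCommGroup A] [NormedSpace ℝ A]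
    {f : A → Fin m → ℝ} {x : A} (hf : AnalyticAt ℝ f x) :
    AnalyticAt ℝ (fun y => mono l (f y)) x := by
  induction l with
  | nil => simpa [mono] using analyticAt_const
  | cons i l ih =>
    simp only [mono_cons]
    fun_prop

theorem mono_zero {m : ℕ} {l : List (Fin m)} (hl : l ≠ []) : mono l (0 : Fin m → ℝ) = 0 := by
  cases l with
  | nil => simp at hl
  | cons i l => simp [mono_cons]

theorem mon_fst {m : ℕ} (i : Fin m) : Mon (cP m) (fun p => p.1 i) := Mon.coord (cP m) (some i)
theorem mon_snd {m : ℕ} : Mon (cP m) (fun p => p.2) := Mon.coord (cP m) none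

theorem toric {ι : Type*} (U : Ultrafilter ι) {m : ℕ} (l : List (Fin m)) :
    ∀ (s : ι → Fin m → ℝ) (z : ι → ℝ), Tendsto s U (𝓝 0) → Tendsto z U (𝓝 0) →
      (∀ᶠ n in (U : Filter ι), z n ≠ 0) → Tendsto (fun n => mono l (s n) / z n) U (𝓝 0) →
    ∃ (π : (Fin m → ℝ) × ℝ → (Fin m → ℝ) × ℝ) (u : ι → (Fin m → ℝ) × ℝ),
      Ref U (fun n => (s n, z n)) π u ∧ (∀ i, Mon (cP m) (fun p => (π p).1 i)) ∧
      Mon (cP m) (fun p => (π p).2) ∧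
      ∃ q : (Fin m → ℝ) × ℝ → ℝ, AnalyticAt ℝ q 0 ∧ q 0 = 0 ∧
        ∀ᶠ p in 𝓝 (0 : (Fin m → ℝ) × ℝ), mono l (π p).1 = (π p).2 * q p := by
  induction l with
  | nil =>
    intro s z hs hz hz0 hd
    exfalso
    have h1 := hd.mul hz
    rw [zero_mul] at h1
    have h2 : Tendsto (fun _ : ι => (1:ℝ)) U (𝓝 0) := by
      refine h1.congr' ?_
      filter_upwards [hz0] with n hn
      simp [mono, hn]
    have := tendsto_nhds_unique h2 tendsto_const_nhds
    norm_num at this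
  | cons i l ih =>
    intro s z hs hz hz0 hd
    have hsi : Tendsto (fun n => s n i) U (𝓝 0) := by
      have := (tendsto_pi_nhds.1 hs) i; simpa using this
    rcases dichotomy U z (fun n => s n i) with ⟨w, w0, hw, hzw⟩ | ⟨_, ht⟩
    · by_cases hw0 : w0 = 0
      · subst hw0
        have hwn : ∀ᶠ n in (U : Filter ι), w n ≠ 0 := by
          filter_upwards [hz0, hzw] with n h1 h2 h3
          rw [h3, mul_zero] at h2; exact h1 h2
        obtain ⟨π, u, hR, hm1, hm2, q, hq, hq0, hqe⟩ := ih s w hs hw hwn (by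
          refine hd.congr' ?_
          filter_upwards [hz0, hzw] with n h1 h2
          rw [h2, mono_cons]
          rw [h2] at h1
          have h3 := left_ne_zero_of_mul h1
          have h4 := right_ne_zero_of_mul h1
          field_simp)
        have hR0 : Ref U (fun n => (s n, z n))
            (fun p : (Fin m → ℝ) × ℝ => (p.1, p.1 i * p.2)) (fun n => (s n, w n)) :=
          ⟨by fun_prop, by simp, hs.prodMk_nhds hw, by
            filter_upwards [hzw] with n h1; rw [h1]⟩
        refine ⟨_, u, hR0.comp hR, hm1, (hm1 i).mul hm2, q, hq, hq0, ?_⟩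
        filter_upwards [hqe] with p hp
        simp only [mono_cons]
        rw [hp]; ring
      · have hl : l ≠ [] := by
          rintro rfl
          have h1 : Tendsto (fun n => mono [i] (s n) / z n * w n) U (𝓝 (0 * w0)) := hd.mul hw
          rw [zero_mul] at h1
          have h2 : Tendsto (fun _ : ι => (1:ℝ)) U (𝓝 0) := by
            refine h1.congr' ?_
            filter_upwards [hz0, hzw] with n h1 h2
            rw [h2] at h1 ⊢
            have h3 := left_ne_zero_of_mul h1
            have h4 := right_ne_zero_of_mul h1
            simp [mono]
            field_simp
          have := tendsto_nhds_unique h2 tendsto_const_nhds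
          norm_num at this
        have hw' : Tendsto (fun n => w n - w0) U (𝓝 0) := by
          have := hw.sub_const w0; simpa using this
        have hun : AnalyticAt ℝ (fun p : (Fin m → ℝ) × ℝ => w0 + p.2) 0 := by fun_prop
        refine ⟨fun p => (p.1, p.1 i * (w0 + p.2)), fun n => (s n, w n - w0),
          ⟨by fun_prop, by simp, hs.prodMk_nhds hw', by
            filter_upwards [hzw] with n h1; rw [h1]; simp⟩,
          fun j => mon_fst j, (mon_fst i).mul (Mon.unit _ hun (by simpa using hw0)),
          fun p => mono l p.1 / (w0 + p.2), ?_, ?_, ?_⟩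
        · exact AnalyticAt.div (by fun_prop) hun (by simpa using hw0)
        · simp [mono_zero hl]
        · have : ∀ᶠ p in 𝓝 (0 : (Fin m → ℝ) × ℝ), w0 + p.2 ≠ 0 :=
            hun.continuousAt.eventually_ne (by simpa using hw0)
          filter_upwards [this] with p hp
          simp only [mono_cons]
          field_simp
    · have hpa : AnalyticAt ℝ (fun p : (Fin m → ℝ) × ℝ =>
          ((Function.update p.1 i (p.1 i * p.2), p.2) : (Fin m → ℝ) × ℝ)) 0 := by
        refine AnalyticAt.prod (an_pi fun j => ?_) (by fun_prop)
        by_cases hj : j = i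
        · subst hj; simp only [Function.update_self]; fun_prop
        · simp only [Function.update_of_ne hj]; fun_prop
      refine ⟨fun p => (Function.update p.1 i (p.1 i * p.2), p.2),
        fun n => (Function.update (s n) i (s n i / z n), z n), ⟨hpa, ?_, ?_, ?_⟩, ?_, mon_snd,
        fun p => p.1 i * mono l (Function.update p.1 i (p.1 i * p.2)), ?_, ?_, ?_⟩
      · simp
      · refine Tendsto.prodMk_nhds (tendsto_pi_nhds.2 fun j => ?_) hz
        by_cases hj : j = i
        · subst hj; simpa using ht
        · simpa [Function.update_of_ne hj] using (tendsto_pi_nhds.1 hs) j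
      · filter_upwards [hz0] with n hn
        simp [hn]
      · intro j
        by_cases hj : j = i
        · subst hj; simpa using (mon_fst j).mul mon_snd
        · simpa [Function.update_of_ne hj] using mon_fst j
      · have : AnalyticAt ℝ (fun p : (Fin m → ℝ) × ℝ => Function.update p.1 i (p.1 i * p.2)) 0 :=
          an_fst hpa
        fun_prop
      · simp
      · refine Eventually.of_forall fun p => ?_
        simp only [mono_cons, Function.update_self]
        ring

end LojGrad

namespace LojGrad

open Filter Topology Set

theorem comb {m : ℕ} (α β : Fin m → ℕ)
    (h : ∀ N : Fin m → ℕ, (∀ i, 1 ≤ N i) → ∑ i, α i * N i = ∑ i, β i * N i) (k : Fin m) :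
    α k = β k := by
  have h1 := h (fun _ => 1) (fun _ => le_rfl)
  have h2 := h (fun i => 1 + (Pi.single k 1 : Fin m → ℕ) i) (fun _ => by omega)
  simp only [mul_add, Finset.sum_add_distrib, mul_one] at h1 h2
  have h3 : ∀ α : Fin m → ℕ, ∑ i, α i * (Pi.single k 1 : Fin m → ℕ) i = α k := by
    intro α
    rw [Finset.sum_eq_single k] <;> simp +contextual
  rw [h3, h3] at h2
  omega

theorem comb_half {m : ℕ} (α β γ : Fin m → ℕ)
    (h : ∀ N : Fin m → ℕ, (∀ i, 1 ≤ N i) → ∑ i, α i * N i < ∑ i, β i * N i →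
      ∑ i, γ i * N i = ∑ i, α i * N i) (k : Fin m) (hk : α k < β k) (M : Fin m → ℕ)
    (hM : ∀ i, 1 ≤ M i) : ∑ i, γ i * M i = ∑ i, α i * M i := by
  have h3 : ∀ (α : Fin m → ℕ) (K : ℕ), ∑ i, α i * (M i + (Pi.single k K : Fin m → ℕ) i)
      = ∑ i, α i * M i + α k * K := by
    intro α K
    simp only [mul_add, Finset.sum_add_distrib]
    congr 1
    rw [Finset.sum_eq_single k] <;> simp +contextual
  have key : ∀ K, ∑ i, α i * M i < K → ∑ i, γ i * M i + γ k * K = ∑ i, α i * M i + α k * K := by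
    intro K hK
    have := h (fun i => M i + (Pi.single k K : Fin m → ℕ) i) (fun i => (hM i).trans (by omega))
    simp only [h3] at this
    refine this ?_
    have : (α k + 1) * K ≤ β k * K := Nat.mul_le_mul_right _ hk
    rw [add_mul, one_mul] at this
    omega
  have k1 := key (∑ i, α i * M i + 1) (by omega)
  have k2 := key (∑ i, α i * M i + 1 + 1) (by omega)
  rw [mul_add (γ k) _ 1, mul_add (α k) _ 1] at k2
  have : γ k = α k := by omega
  rw [this] at k1
  omega

theorem ord_curve {m : ℕ} {f h : (Fin m → ℝ) → ℝ} (α : Fin m → ℕ) (hh : AnalyticAt ℝ h 0)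
    (h0 : h 0 ≠ 0) (e : f =ᶠ[𝓝 0] fun x => (∏ i, cF m i x ^ α i) * h x) (N : Fin m → ℕ)
    (hN : ∀ i, 1 ≤ N i) :
    AnalyticAt ℝ (fun t : ℝ => f (fun l => t ^ N l)) 0 ∧
    analyticOrderAt (fun t : ℝ => f (fun l => t ^ N l)) 0 = ((∑ i, α i * N i : ℕ) : ℕ∞) := by
  have hγ : AnalyticAt ℝ (fun t : ℝ => (fun l => t ^ N l : Fin m → ℝ)) 0 :=
    an_pi fun i => by fun_prop
  have hγ0 : (fun l => (0:ℝ) ^ N l : Fin m → ℝ) = 0 := by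
    funext l; simp; have := hN l; omega
  have hk : AnalyticAt ℝ (fun t : ℝ => h (fun l => t ^ N l)) 0 :=
    AnalyticAt.comp_of_eq hh hγ hγ0
  have e' : (fun t : ℝ => f (fun l => t ^ N l)) =ᶠ[𝓝 0]
      fun t => t ^ (∑ i, α i * N i) * h (fun l => t ^ N l) := by
    have := (tendsto_of_an hγ hγ0).eventually e
    filter_upwards [this] with t ht
    rw [ht]
    simp only [cF, ← pow_mul]
    rw [Finset.prod_pow_eq_pow_sum]
    simp only [mul_comm]
  have han : AnalyticAt ℝ (fun t : ℝ => f (fun l => t ^ N l)) 0 := by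
    refine AnalyticAt.congr ?_ e'.symm
    exact (analyticAt_id.pow _).mul hk
  refine ⟨han, ?_⟩
  rw [han.analyticOrderAt_eq_natCast]
  refine ⟨_, hk, by rwa [hγ0], ?_⟩
  filter_upwards [e'] with t ht
  rw [ht]; simp

theorem diff_lemma {m : ℕ} {p q s t : (Fin m → ℝ) → ℝ} {α β : Fin m → ℕ}
    (hs : AnalyticAt ℝ s 0) (ht : AnalyticAt ℝ t 0) (hs0 : s 0 ≠ 0) (ht0 : t 0 ≠ 0)
    (hp : p =ᶠ[𝓝 0] fun x => (∏ i, cF m i x ^ α i) * s x)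
    (hq : q =ᶠ[𝓝 0] fun x => (∏ i, cF m i x ^ β i) * t x)
    (hd : MonZ (cF m) (fun x => p x - q x)) : (∀ i, α i ≤ β i) ∨ (∀ i, β i ≤ α i) := by
  by_contra hcon
  push Not at hcon
  obtain ⟨⟨j, hj⟩, ⟨k, hk⟩⟩ := hcon
  have P := ord_curve α hs hs0 hp
  have Q := ord_curve β ht ht0 hq
  suffices h : ∀ N : Fin m → ℕ, (∀ i, 1 ≤ N i) → ∑ i, α i * N i = ∑ i, β i * N i by
    have := comb α β h k; omega
  rcases hd with hd | ⟨γ, r, hr, hr0, hd⟩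
  · intro N hN
    have hpq : p =ᶠ[𝓝 0] fun x => (∏ i, cF m i x ^ β i) * t x := by
      filter_upwards [hd, hq] with x h1 h2
      have h1 : p x - q x = 0 := h1
      rw [← h2]; linarith
    have P' := ord_curve β ht ht0 hpq N hN
    have := (P N hN).2.symm.trans P'.2
    exact_mod_cast this
  · have D := ord_curve γ hr hr0 hd
    have e1 : ∀ N : Fin m → ℕ, (∀ i, 1 ≤ N i) → ∑ i, γ i * N i = ∑ i, α i * N i := by
      refine comb_half α β γ ?_ k hk
      intro N hN hlt
      have h1 := P N hN
      have h2 := Q N hN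
      have h3 := D N hN
      have h4 := analyticOrderAt_add_eq_left_of_lt (f := fun t : ℝ => p (fun l => t ^ N l))
        (g := - fun t : ℝ => q (fun l => t ^ N l)) (z₀ := 0) (by
          rw [analyticOrderAt_neg, h1.2, h2.2]; exact_mod_cast hlt)
      have h5 := h3.2.symm.trans ((congrArg (fun f => analyticOrderAt f 0) (by
        funext t; simp [sub_eq_add_neg])).trans (h4.trans h1.2))
      exact_mod_cast h5
    have e2 : ∀ N : Fin m → ℕ, (∀ i, 1 ≤ N i) → ∑ i, γ i * N i = ∑ i, β i * N i := by
      refine comb_half β α γ ?_ j hj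
      intro N hN hlt
      have h1 := P N hN
      have h2 := Q N hN
      have h3 := D N hN
      have h4 := analyticOrderAt_add_eq_right_of_lt (f := fun t : ℝ => p (fun l => t ^ N l))
        (g := - fun t : ℝ => q (fun l => t ^ N l)) (z₀ := 0) (by
          rw [analyticOrderAt_neg, h1.2, h2.2]; exact_mod_cast hlt)
      rw [analyticOrderAt_neg] at h4
      have h5 := h3.2.symm.trans ((congrArg (fun f => analyticOrderAt f 0) (by
        funext t; simp [sub_eq_add_neg])).trans (h4.trans h2.2))
      exact_mod_cast h5
    intro N hN
    rw [← e1 N hN, e2 N hN]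

theorem exists_mono {m : ℕ} (β : Fin m → ℕ) : ∃ l : List (Fin m), ∀ s, mono l s = ∏ i, s i ^ β i := by
  classical
  have : ∀ S : Finset (Fin m), ∃ l : List (Fin m), ∀ s, mono l s = ∏ i ∈ S, s i ^ β i := by
    intro S
    induction S using Finset.induction_on with
    | empty => exact ⟨[], fun s => by simp [mono]⟩
    | insert a S ha ih =>
      obtain ⟨l, hl⟩ := ih
      refine ⟨List.replicate (β a) a ++ l, fun s => ?_⟩
      rw [Finset.prod_insert ha, ← hl]
      simp [mono]
  exact this _

/-- uniformization along an ultrafilter -/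
def Uni {ι : Type} (U : Ultrafilter ι) (m : ℕ) : Prop :=
  ∀ y : ι → (Fin m → ℝ), Tendsto y U (𝓝 0) → ∀ F : Set ((Fin m → ℝ) → ℝ), F.Finite →
    (∀ f ∈ F, AnalyticAt ℝ f 0) → ∃ (π : (Fin m → ℝ) → (Fin m → ℝ)) (u : ι → (Fin m → ℝ)),
      Ref U y π u ∧ ∀ f ∈ F, MonZ (cF m) (fun x => f (π x))

theorem exists_sign {ι : Type} (U : Ultrafilter ι) (a : ι → ℝ) :
    ∃ ε : ℝ, ε ≠ 0 ∧ ∀ᶠ n in (U : Filter ι), a n = ε * |a n| := by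
  rcases U.em (fun n => 0 ≤ a n) with h | h
  · refine ⟨1, one_ne_zero, ?_⟩
    filter_upwards [h] with n hn
    rw [abs_of_nonneg hn, one_mul]
  · refine ⟨-1, by norm_num, ?_⟩
    filter_upwards [h] with n hn
    rw [abs_of_neg (not_le.1 hn)]; ring

theorem root {ι : Type} {U : Ultrafilter ι} {m : ℕ} (hU : Uni U m) {y : ι → (Fin m → ℝ)}
    (hy : Tendsto y U (𝓝 0)) {P : Type} [Fintype P] (a : P → (Fin m → ℝ) → ℝ) (e : P → ℕ)
    (he : ∀ p, 0 < e p) (ha : ∀ p, AnalyticAt ℝ (a p) 0) {G : Set ((Fin m → ℝ) → ℝ)}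
    (hGf : G.Finite) (hG : ∀ g ∈ G, AnalyticAt ℝ g 0) :
    ∃ (π : (Fin m → ℝ) → (Fin m → ℝ)) (u : ι → (Fin m → ℝ)), Ref U y π u ∧
      (∀ g ∈ G, MonZ (cF m) (fun x => g (π x))) ∧
      ((∀ p, (fun x => a p (π x)) =ᶠ[𝓝 0] 0) ∨
        ∃ (l : List (Fin m)) (b : P → (Fin m → ℝ) → ℝ), (∀ p, AnalyticAt ℝ (b p) 0) ∧
          (∀ p, (fun x => a p (π x)) =ᶠ[𝓝 0] fun x => mono l x ^ e p * b p x) ∧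
          ∃ p, b p 0 ≠ 0) := by
  classical
  set N := ∏ p, e p with hN
  have hN0 : 0 < N := Finset.prod_pos fun p _ => he p
  have hdv : ∀ p, ∃ k, N = e p * k := fun p => Finset.dvd_prod_of_mem e (Finset.mem_univ p)
  choose k hk using hdv
  obtain ⟨π, u, hR, hM⟩ := hU y hy
    (G ∪ (range a ∪ range (fun pq : P × P => fun x => a pq.1 x ^ k pq.1 - a pq.2 x ^ k pq.2)))
    (hGf.union ((finite_range _).union (finite_range _))) (by
      rintro f (hf | ⟨p, rfl⟩ | ⟨pq, rfl⟩)
      · exact hG f hf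
      · exact ha p
      · exact ((ha _).pow _).sub ((ha _).pow _))
  have hMG : ∀ g ∈ G, MonZ (cF m) (fun x => g (π x)) := fun g hg => hM g (Or.inl hg)
  have hMa : ∀ p, MonZ (cF m) (fun x => a p (π x)) := fun p => hM _ (Or.inr (Or.inl ⟨p, rfl⟩))
  have hMd : ∀ p q, MonZ (cF m) (fun x => a p (π x) ^ k p - a q (π x) ^ k q) :=
    fun p q => hM _ (Or.inr (Or.inr ⟨(p, q), rfl⟩))
  by_cases hz : ∀ p, (fun x => a p (π x)) =ᶠ[𝓝 0] 0
  · exact ⟨π, u, hR, hMG, Or.inl hz⟩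
  push Not at hz
  have hch : ∀ p, ∃ (α : Fin m → ℕ) (h : (Fin m → ℝ) → ℝ), ¬ ((fun x => a p (π x)) =ᶠ[𝓝 0] 0) →
      AnalyticAt ℝ h 0 ∧ h 0 ≠ 0 ∧
      (fun x => a p (π x)) =ᶠ[𝓝 0] fun x => (∏ i, cF m i x ^ α i) * h x := by
    intro p
    rcases hMa p with h | ⟨α, h, h1⟩
    · exact ⟨0, 0, fun h' => (h' h).elim⟩
    · exact ⟨α, h, fun _ => h1⟩
  choose α h hαh using hch
  set S : Finset P := Finset.univ.filter fun p => ¬ ((fun x => a p (π x)) =ᶠ[𝓝 0] 0) with hS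
  have hSn : S.Nonempty := by
    obtain ⟨p, hp⟩ := hz
    exact ⟨p, by simpa [hS] using hp⟩
  obtain ⟨p₀, hp₀, hmin⟩ := S.exists_min_image (fun p => ∑ i, k p * α p i) hSn
  have hp₀' := hαh p₀ (by simpa [hS] using hp₀)
  have hkpow : ∀ p ∈ S, (fun x => a p (π x) ^ k p) =ᶠ[𝓝 0]
      fun x => (∏ i, cF m i x ^ (k p * α p i)) * h p x ^ k p := by
    intro p hp
    have hp' := hαh p (by simpa [hS] using hp)
    filter_upwards [hp'.2.2] with x hx
    rw [hx, mul_pow, ← Finset.prod_pow]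
    simp only [← pow_mul, mul_comm]
  have hle : ∀ p ∈ S, ∀ i, k p₀ * α p₀ i ≤ k p * α p i := by
    intro p hp
    have hp' := hαh p (by simpa [hS] using hp)
    rcases diff_lemma (hp₀'.1.pow (k p₀)) (hp'.1.pow (k p)) (pow_ne_zero _ hp₀'.2.1)
      (pow_ne_zero _ hp'.2.1) (hkpow p₀ hp₀) (hkpow p hp) (hMd p₀ p) with hc | hc
    · exact hc
    · have h1 := hmin p hp
      have h2 := Finset.sum_le_sum fun i (_ : i ∈ Finset.univ) => hc i
      have h3 := (Finset.sum_eq_sum_iff_of_le fun i (_ : i ∈ Finset.univ) => hc i).1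
        (le_antisymm h2 h1)
      exact fun i => (h3 i (Finset.mem_univ i)).ge
  choose ε hε0 hε using fun i => exists_sign U (fun n => u n i)
  have hψ : AnalyticAt ℝ (fun s : Fin m → ℝ => fun i => ε i * s i ^ N) 0 :=
    an_pi fun i => by fun_prop
  have hψ0 : (fun s : Fin m → ℝ => fun i => ε i * s i ^ N) 0 = 0 := by
    funext i; simp [hN0.ne']
  have hR' : Ref U u (fun s : Fin m → ℝ => fun i => ε i * s i ^ N)
      (fun n i => |u n i| ^ ((1:ℝ) / N)) := by
    refine ⟨hψ, hψ0, ?_, ?_⟩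
    · refine tendsto_pi_nhds.2 fun i => ?_
      have h1 : Tendsto (fun n => |u n i|) U (𝓝 0) := by
        have := ((tendsto_pi_nhds.1 hR.tends) i).abs; simpa using this
      have hpos : (0:ℝ) < 1 / N := by positivity
      have h2 := h1.rpow_const (p := (1:ℝ)/N) (Or.inr hpos.le)
      rwa [Real.zero_rpow hpos.ne'] at h2
    · have := eventually_all.2 hε
      filter_upwards [this] with n hn
      funext i
      rw [hn i, ← Real.rpow_natCast, ← Real.rpow_mul (abs_nonneg _), one_div,
        inv_mul_cancel₀ (by positivity), Real.rpow_one]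
      rw [← hn i]
      exact hn i
  have hcψ : ∀ i, Mon (cF m) (fun s : Fin m → ℝ => cF m i (fun i => ε i * s i ^ N)) := by
    intro i
    exact (Mon.unit _ analyticAt_const (hε0 i)).mul ((Mon.coord (cF m) i).pow N)
  obtain ⟨l, hl⟩ := exists_mono (fun i => k p₀ * α p₀ i)
  refine ⟨_, _, hR.comp hR', fun g hg => (hMG g hg).comp hψ hψ0 hcψ, Or.inr ⟨l, fun p =>
    if p ∈ S then fun s => (∏ i, ε i ^ α p i * s i ^ (e p * (k p * α p i - k p₀ * α p₀ i))) *
      h p (fun i => ε i * s i ^ N) else fun _ => 0, ?_, ?_, ?_⟩⟩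
  · intro p
    beta_reduce
    split_ifs with hp
    · have hp' := hαh p (by simpa [hS] using hp)
      have : AnalyticAt ℝ (fun s : Fin m → ℝ => h p (fun i => ε i * s i ^ N)) 0 :=
        AnalyticAt.comp_of_eq hp'.1 hψ hψ0
      refine AnalyticAt.mul (Finset.analyticAt_fun_prod _ fun i _ => ?_) this
      fun_prop
    · exact analyticAt_const
  · intro p
    beta_reduce
    split_ifs with hp
    · have hp' := hαh p (by simpa [hS] using hp)
      filter_upwards [(tendsto_of_an hψ hψ0).eventually hp'.2.2] with s hs
      rw [hs, hl, ← mul_assoc, ← Finset.prod_pow, ← Finset.prod_mul_distrib]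
      congr 1
      refine Finset.prod_congr rfl fun i _ => ?_
      simp only [cF]
      rw [mul_pow, ← pow_mul, ← pow_mul, mul_left_comm, ← pow_add]
      congr 2
      have := hle p hp i
      obtain ⟨d, hd⟩ := Nat.exists_eq_add_of_le this
      have h2 : N * α p i = e p * (k p * α p i) := by rw [hk p]; ring
      rw [h2, hd, Nat.add_sub_cancel_left]; ring
    · have : (fun x => a p (π x)) =ᶠ[𝓝 0] 0 := by
        by_contra hcon
        exact hp (by simpa [hS] using hcon)
      filter_upwards [(tendsto_of_an hψ hψ0).eventually this] with s hs
      rw [hs]; simp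
  · refine ⟨p₀, ?_⟩
    simp only [hp₀, if_true]
    have h1 : h p₀ (fun i => ε i * (0 : Fin m → ℝ) i ^ N) ≠ 0 := by
      have : (fun i => ε i * (0 : Fin m → ℝ) i ^ N) = 0 := hψ0
      rw [this]; exact hp₀'.2.1
    refine mul_ne_zero (Finset.prod_ne_zero_iff.2 fun i _ => ?_) h1
    simp [hε0 i]

end LojGrad

namespace LojGrad

open Filter Topology Set

theorem poly_lemma (D : ℕ) (c : Fin D → ℝ) (H : ℝ) (hH : H ≠ 0) (w0 : ℝ) :
    ∃ D' ≤ D, ∃ u : ℝ → ℝ, AnalyticAt ℝ u 0 ∧ u 0 ≠ 0 ∧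
      (∀ t, ∑ i : Fin D, c i * (w0 + t) ^ (i : ℕ) + (w0 + t) ^ D * H = t ^ D' * u t) ∧
      (D' = D → ∀ i : Fin D, c i = H * ((-w0) ^ (D - i : ℕ) * D.choose i)) := by
  classical
  set q : Polynomial ℝ := ∑ i : Fin D, Polynomial.C (c i) * Polynomial.X ^ (i : ℕ) with hq
  set p : Polynomial ℝ := q + Polynomial.C H * Polynomial.X ^ D with hp
  have hqd : q.degree < D := by
    rw [hq]
    refine (Polynomial.degree_sum_le _ _).trans_lt ?_
    rw [Finset.sup_lt_iff (by exact WithBot.bot_lt_coe D)]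
    intro i _
    refine (Polynomial.degree_C_mul_X_pow_le _ _).trans_lt ?_
    exact_mod_cast i.2
  have hpd : p.degree = D := by
    rw [hp, Polynomial.degree_add_eq_right_of_degree_lt] <;>
      rw [Polynomial.degree_C_mul_X_pow _ hH]
    exact hqd
  have hpn : p.natDegree = D := Polynomial.natDegree_eq_of_degree_eq_some hpd
  have hp0 : p ≠ 0 := by
    rintro h; rw [h] at hpd; simp at hpd
  have hlead : p.leadingCoeff = H := by
    rw [Polynomial.leadingCoeff, hpn, hp, Polynomial.coeff_add,
      Polynomial.coeff_eq_zero_of_degree_lt hqd]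
    simp
  have hcoef : ∀ i : Fin D, p.coeff i = c i := by
    intro i
    rw [hp, Polynomial.coeff_add, hq, Polynomial.finsetSum_coeff, Finset.sum_eq_single i]
    · simp [i.2.ne]
    · intro j _ hj
      have : (i : ℕ) ≠ j := fun h => hj (Fin.ext h.symm)
      simp [Polynomial.coeff_X_pow, this]
    · simp
  obtain ⟨k, hk, hkn⟩ := Polynomial.exists_eq_pow_rootMultiplicity_mul_and_not_dvd p hp0 w0
  have hle : p.rootMultiplicity w0 ≤ D := by
    have := Polynomial.natDegree_le_of_dvd (Polynomial.pow_rootMultiplicity_dvd p w0) hp0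
    rwa [hpn, Polynomial.natDegree_pow, Polynomial.natDegree_X_sub_C, mul_one] at this
  refine ⟨p.rootMultiplicity w0, hle, fun t => k.eval (w0 + t), ?_, ?_, ?_, ?_⟩
  · have : AnalyticAt ℝ (fun t : ℝ => w0 + t) 0 := by fun_prop
    have h2 := this.aeval_polynomial k
    simpa [Polynomial.aeval_def] using h2
  · rw [Polynomial.dvd_iff_isRoot] at hkn
    simpa using hkn
  · intro t
    have : p.eval (w0 + t) = ∑ i : Fin D, c i * (w0 + t) ^ (i : ℕ) + (w0 + t) ^ D * H := by
      rw [hp, hq]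
      simp [Polynomial.eval_finsetSum, mul_comm H]
    rw [← this]
    conv_lhs => rw [hk]
    simp
  · intro hD i
    rw [hD] at hk
    have hk0 : k ≠ 0 := by rintro rfl; simp at hkn
    have hdeg := congrArg Polynomial.natDegree hk
    rw [hpn, Polynomial.natDegree_mul (pow_ne_zero _ (Polynomial.X_sub_C_ne_zero _)) hk0,
      Polynomial.natDegree_pow, Polynomial.natDegree_X_sub_C] at hdeg
    have hkd : k.natDegree = 0 := by omega
    rw [Polynomial.eq_C_of_natDegree_eq_zero hkd] at hk
    have hkH : k.coeff 0 = H := by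
      rw [← hlead, hk]
      simp [Polynomial.leadingCoeff_mul]
    rw [hkH] at hk
    rw [← hcoef, hk, Polynomial.coeff_mul_C, sub_eq_add_neg, ← Polynomial.C_neg,
      Polynomial.coeff_X_add_C_pow]
    ring

theorem mono_not_zero {m : ℕ} (l : List (Fin m)) :
    ¬ ∀ᶠ x in 𝓝 (0 : Fin m → ℝ), mono l x = 0 := by
  intro h
  have hc : Tendsto (fun t : ℝ => (fun _ => t : Fin m → ℝ)) (𝓝[≠] 0) (𝓝 0) := by
    refine tendsto_pi_nhds.2 fun i => ?_
    exact tendsto_nhdsWithin_of_tendsto_nhds tendsto_id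
  have h1 := hc.eventually h
  obtain ⟨t, ht, ht0⟩ := (h1.and self_mem_nhdsWithin).exists
  simp [mono] at ht
  exact ht0 ht.1

theorem Reg.shift {m : ℕ} {f : (Fin m → ℝ) × ℝ → ℝ} {D : ℕ} (h : Reg f D) {φ : (Fin m → ℝ) → ℝ}
    (h0 : φ 0 = 0) : Reg (fun p => f (p.1, p.2 + φ p.1)) D := by
  obtain ⟨u, h1, h2, h3⟩ := h
  refine ⟨u, h1, h2, ?_⟩
  filter_upwards [h3] with t ht
  simpa [h0] using ht

theorem Reg.zero {m : ℕ} {f : (Fin m → ℝ) × ℝ → ℝ} (h : Reg f 0) : f 0 ≠ 0 := by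
  obtain ⟨u, h1, h2, h3⟩ := h
  have := h3.self_of_nhds
  rw [pow_zero, one_mul] at this
  have h4 : f 0 = u 0 := this
  rwa [h4]

end LojGrad

namespace LojGrad

open Filter Topology Set

theorem fstmon {m : ℕ} {g : (Fin m → ℝ) → ℝ} (h : MonZ (cF m) g) :
    MonZ (cP m) (fun p => g p.1) :=
  MonZ.comp (c := cF m) (c' := cP m) (π := fun p : (Fin m → ℝ) × ℝ => p.1) h (by fun_prop) rfl
    (fun i => mon_fst i)

theorem Ref.prodId {ι : Type} {U : Ultrafilter ι} {m : ℕ} {y u : ι → Fin m → ℝ} {z : ι → ℝ}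
    {π : (Fin m → ℝ) → (Fin m → ℝ)} (h : Ref U y π u) (hz : Tendsto z U (𝓝 0)) :
    Ref U (fun n => (y n, z n)) (fun p : (Fin m → ℝ) × ℝ => (π p.1, p.2))
      (fun n => (u n, z n)) where
  an := by
    have : AnalyticAt ℝ (fun p : (Fin m → ℝ) × ℝ => π p.1) 0 :=
      AnalyticAt.comp_of_eq (g := π) (f := fun p : (Fin m → ℝ) × ℝ => p.1) h.an (by fun_prop) rfl
    exact this.prod (by fun_prop)
  zero := by simp [h.zero]
  tends := h.tends.prodMk_nhds hz
  eq := by filter_upwards [h.eq] with n hn; rw [hn]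

theorem Rind {ι : Type} {U : Ultrafilter ι} {m : ℕ} (hU : Uni U m) (d : ℕ) :
    ∀ (y : ι → (Fin m → ℝ)) (z : ι → ℝ), Tendsto y U (𝓝 0) → Tendsto z U (𝓝 0) →
    ∀ (J : Type) [Fintype J] (f : J → (Fin m → ℝ) × ℝ → ℝ) (D : J → ℕ),
      (∀ j, AnalyticAt ℝ (f j) 0) → (∀ j, Reg (f j) (D j)) → ∑ j, D j = d →
    ∀ G : Set ((Fin m → ℝ) → ℝ), G.Finite → (∀ g ∈ G, AnalyticAt ℝ g 0) →
    ∃ (π : (Fin m → ℝ) × ℝ → (Fin m → ℝ) × ℝ) (u : ι → (Fin m → ℝ) × ℝ),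
      Ref U (fun n => (y n, z n)) π u ∧ (∀ j, MonZ (cP m) (fun p => f j (π p))) ∧
      ∀ g ∈ G, MonZ (cP m) (fun p => g (π p).1) := by
  induction d using Nat.strong_induction_on with
  | _ d ih =>
  intro y z hy hz J _ f D hf hr hd G hGf hG
  classical
  by_cases hall : ∀ j, D j = 0
  · obtain ⟨π, u, hR, hM⟩ := hU y hy G hGf hG
    refine ⟨_, _, hR.prodId hz, fun j => ?_, fun g hg => fstmon (hM g hg)⟩
    have h1 : Reg (f j) 0 := hall j ▸ hr j
    have h2 := (hR.prodId hz).an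
    have h3 := (hR.prodId hz).zero
    exact Or.inr (Mon.unit _ (AnalyticAt.comp_of_eq (hf j) h2 h3) (by rw [h3]; exact h1.zero))
  push Not at hall
  obtain ⟨j0, hj0⟩ := hall
  obtain ⟨n, hn⟩ : ∃ n, D j0 = n + 1 := ⟨D j0 - 1, by omega⟩
  obtain ⟨φ, hφ, hφ0, a', h', ha', hh', he', hz'⟩ := tschirnhaus (hf j0) n (by rw [← hn]; exact hr j0)
  set F : J → (Fin m → ℝ) × ℝ → ℝ := fun j p => f j (p.1, p.2 + φ p.1) with hF
  have hσ : AnalyticAt ℝ (fun p : (Fin m → ℝ) × ℝ => ((p.1, p.2 + φ p.1) : (Fin m → ℝ) × ℝ)) 0 := by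
    have : AnalyticAt ℝ (fun p : (Fin m → ℝ) × ℝ => φ p.1) 0 :=
      AnalyticAt.comp_of_eq (g := φ) (f := fun p : (Fin m → ℝ) × ℝ => p.1) hφ (by fun_prop) rfl
    fun_prop
  have hσ0 : (fun p : (Fin m → ℝ) × ℝ => ((p.1, p.2 + φ p.1) : (Fin m → ℝ) × ℝ)) 0 = 0 := by
    simp [hφ0]
  have hFa : ∀ j, AnalyticAt ℝ (F j) 0 := fun j => AnalyticAt.comp_of_eq (hf j) hσ hσ0
  have hFr : ∀ j, Reg (F j) (D j) := fun j => (hr j).shift hφ0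
  set z1 : ι → ℝ := fun k => z k - φ (y k) with hz1
  have hz1t : Tendsto z1 U (𝓝 0) := by
    have := hz.sub ((tendsto_of_an hφ hφ0).comp hy); simpa using this
  have hR0 : Ref U (fun k => (y k, z k))
      (fun p : (Fin m → ℝ) × ℝ => ((p.1, p.2 + φ p.1) : (Fin m → ℝ) × ℝ))
      (fun k => (y k, z1 k)) :=
    ⟨hσ, hσ0, hy.prodMk_nhds hz1t, Eventually.of_forall fun k => by simp [hz1]⟩
  have hexp : ∀ j, ∃ (a : ℕ → (Fin m → ℝ) → ℝ) (h : (Fin m → ℝ) × ℝ → ℝ),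
      (∀ i, AnalyticAt ℝ (a i) 0) ∧ AnalyticAt ℝ h 0 ∧
      (∀ᶠ p in 𝓝 0, F j p = ∑ i : Fin (D j), a i p.1 * p.2 ^ (i : ℕ) + p.2 ^ D j * h p) ∧
      (j = j0 → ∀ᶠ y in 𝓝 0, a n y = 0) ∧ (∀ i < D j, a i 0 = 0) ∧ h 0 ≠ 0 := by
    intro j
    rcases eq_or_ne j j0 with rfl | hj
    · have e : ∀ᶠ p in 𝓝 0, F j p = ∑ i ∈ Finset.range (D j), a' i p.1 * p.2 ^ (i : ℕ)
          + p.2 ^ D j * h' p := by rw [hn]; exact he'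
      refine ⟨a', h', ha', hh', ?_, fun _ => hz', reg_coeffs (hFr j) hh' e⟩
      filter_upwards [e] with p hp
      rw [hp, Finset.sum_range]
    · obtain ⟨a, h, ha, hh, e⟩ := expansion (hFa j) (D j)
      refine ⟨a, h, ha, hh, ?_, fun h => (hj h).elim, reg_coeffs (hFr j) hh e⟩
      filter_upwards [e] with p hp
      rw [hp, Finset.sum_range]
  choose a h ha hh hexp han ha0 hh0 using hexp
  obtain ⟨π1, s, hR1, hG1, hcase⟩ := root hU hy (P := Σ j, Fin (D j)) (fun p => a p.1 p.2)
    (fun p => D p.1 - p.2) (fun p => Nat.sub_pos_of_lt p.2.2) (fun p => ha _ _) hGf hG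
  have hR1' := hR1.prodId hz1t
  have hRR := hR0.comp hR1'
  have hH : ∀ j, AnalyticAt ℝ (fun p : (Fin m → ℝ) × ℝ => h j (π1 p.1, p.2)) 0 :=
    fun j => AnalyticAt.comp_of_eq (hh j) hR1'.an hR1'.zero
  have hH0 : ∀ j, h j (π1 0, 0) ≠ 0 := fun j => by rw [hR1.zero]; exact hh0 j
  have hfst : Tendsto (fun p : (Fin m → ℝ) × ℝ => p.1) (𝓝 0) (𝓝 0) :=
    continuous_fst.tendsto' _ _ rfl
  have hFe : ∀ j, ∀ᶠ p in 𝓝 (0 : (Fin m → ℝ) × ℝ), F j (π1 p.1, p.2) =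
      ∑ i : Fin (D j), a j i (π1 p.1) * p.2 ^ (i : ℕ) + p.2 ^ D j * h j (π1 p.1, p.2) :=
    fun j => (tendsto_of_an hR1'.an hR1'.zero).eventually (hexp j)
  rcases hcase with hzero | ⟨l, b, hb, hbe, ⟨jp, ip⟩, hp0⟩
  · refine ⟨_, _, hRR, fun j => ?_, fun g hg => fstmon (hG1 g hg)⟩
    right
    refine Mon.congr (((mon_snd (m := m)).pow (D j)).mul (Mon.unit _ (hH j) (hH0 j))) ?_
    have hz2 : ∀ᶠ p in 𝓝 (0 : (Fin m → ℝ) × ℝ), ∀ i : Fin (D j), a j i (π1 p.1) = 0 :=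
      eventually_all.2 fun i => hfst.eventually (hzero ⟨j, i⟩)
    filter_upwards [hFe j, hz2] with p hp hp2
    show F j (π1 p.1, p.2) = _
    rw [hp]
    simp [hp2]
  have hFe2 : ∀ j, ∀ᶠ p in 𝓝 (0 : (Fin m → ℝ) × ℝ), F j (π1 p.1, p.2) =
      ∑ i : Fin (D j), (mono l p.1 ^ (D j - i) * b ⟨j, i⟩ p.1) * p.2 ^ (i : ℕ)
        + p.2 ^ D j * h j (π1 p.1, p.2) := by
    intro j
    have hz2 : ∀ᶠ p in 𝓝 (0 : (Fin m → ℝ) × ℝ), ∀ i : Fin (D j),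
        a j i (π1 p.1) = mono l p.1 ^ (D j - i) * b ⟨j, i⟩ p.1 :=
      eventually_all.2 fun i => hfst.eventually (hbe ⟨j, i⟩)
    filter_upwards [hFe j, hz2] with p hp hp2
    rw [hp]
    simp only [hp2]
  have hb' : ∀ q, AnalyticAt ℝ (fun p : (Fin m → ℝ) × ℝ => b q p.1) 0 := fun q =>
    AnalyticAt.comp_of_eq (g := b q) (f := fun p : (Fin m → ℝ) × ℝ => p.1) (hb q) (by fun_prop) rfl
  have hl : l ≠ [] := by
    rintro rfl
    have h1 := (hbe ⟨jp, ip⟩).self_of_nhds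
    simp only [mono, List.map_nil, List.prod_nil, one_pow, one_mul] at h1
    rw [hR1.zero, ha0 jp ip ip.2] at h1
    exact hp0 h1.symm
  rcases dichotomy U z1 (fun k => mono l (s k)) with ⟨w, w0, hw, hzw⟩ | ⟨hzn, ht⟩
  · -- case B
    have hπ2 : AnalyticAt ℝ (fun p : (Fin m → ℝ) × ℝ =>
        ((p.1, mono l p.1 * (w0 + p.2)) : (Fin m → ℝ) × ℝ)) 0 := by fun_prop
    have hπ20 : (fun p : (Fin m → ℝ) × ℝ =>
        ((p.1, mono l p.1 * (w0 + p.2)) : (Fin m → ℝ) × ℝ)) 0 = 0 := by simp [mono_zero hl]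
    have hw' : Tendsto (fun k => w k - w0) U (𝓝 0) := by
      have := hw.sub_const w0; simpa using this
    have hR2 : Ref U (fun k => (s k, z1 k)) (fun p : (Fin m → ℝ) × ℝ =>
        ((p.1, mono l p.1 * (w0 + p.2)) : (Fin m → ℝ) × ℝ)) (fun k => (s k, w k - w0)) :=
      ⟨hπ2, hπ20, hR1.tends.prodMk_nhds hw', by
        filter_upwards [hzw] with k hk; rw [hk]; simp⟩
    set g : J → (Fin m → ℝ) × ℝ → ℝ := fun j p =>
      ∑ i : Fin (D j), b ⟨j, i⟩ p.1 * (w0 + p.2) ^ (i : ℕ) +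
        (w0 + p.2) ^ D j * h j (π1 p.1, mono l p.1 * (w0 + p.2)) with hg
    have hga : ∀ j, AnalyticAt ℝ (g j) 0 := by
      intro j
      refine AnalyticAt.add (Finset.analyticAt_fun_sum _ fun i _ => ?_) (AnalyticAt.mul ?_ ?_)
      · have := hb' ⟨j, i⟩
        fun_prop
      · fun_prop
      · exact AnalyticAt.comp_of_eq (g := fun p : (Fin m → ℝ) × ℝ => h j (π1 p.1, p.2)) (hH j) hπ2 hπ20
    have hpoly := fun j => poly_lemma (D j) (fun i => b ⟨j, i⟩ 0) (h j (π1 0, 0)) (hH0 j) w0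
    choose D' hD' v hv hv0 hve hvD using hpoly
    have hgr : ∀ j, Reg (g j) (D' j) := by
      intro j
      refine ⟨v j, hv j, hv0 j, Eventually.of_forall fun t => ?_⟩
      rw [← hve j t]
      simp only [hg, mono_zero hl, zero_mul]
    have hlt : ∑ j, D' j < d := by
      rw [← hd]
      refine lt_of_le_of_ne (Finset.sum_le_sum fun j _ => hD' j) fun heq => ?_
      have hDD : ∀ j, D' j = D j := fun j =>
        (Finset.sum_eq_sum_iff_of_le fun i _ => hD' i).1 heq j (Finset.mem_univ j)
      have hnlt : n < D j0 := by omega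
      have hb0 : b ⟨j0, ⟨n, hnlt⟩⟩ 0 = 0 := by
        by_contra hne
        apply mono_not_zero l
        have h1 := (hb ⟨j0, ⟨n, hnlt⟩⟩).continuousAt.eventually_ne hne
        have h2 := hbe ⟨j0, ⟨n, hnlt⟩⟩
        have h3 := (tendsto_of_an hR1.an hR1.zero).eventually (han j0 rfl)
        filter_upwards [h1, h2, h3] with x k1 k2 k3
        have k2 : a j0 n (π1 x) = mono l x ^ (D j0 - n) * b ⟨j0, ⟨n, hnlt⟩⟩ x := k2
        rw [k3] at k2
        have := (mul_eq_zero.1 k2.symm).resolve_right k1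
        exact pow_eq_zero_iff (by omega) |>.1 this
      have hw00 : w0 = 0 := by
        have h1 := hvD j0 (hDD j0) ⟨n, hnlt⟩
        rw [hb0] at h1
        have h2 := (mul_eq_zero.1 h1.symm).resolve_left (hH0 j0)
        have h3 : ((D j0).choose n : ℝ) ≠ 0 := by
          exact_mod_cast (Nat.choose_pos hnlt.le).ne'
        have h4 := (mul_eq_zero.1 h2).resolve_right h3
        have h5 := pow_eq_zero_iff (n := D j0 - n) (by omega) |>.1 h4
        linarith
      apply hp0
      have h1 := hvD jp (hDD jp) ip
      rw [h1, hw00, neg_zero, zero_pow (Nat.sub_pos_of_lt ip.2).ne']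
      ring
    obtain ⟨π3, u3, hR3, hM3, hG3⟩ := ih _ hlt s (fun k => w k - w0) hR1.tends hw' J g D' hga hgr rfl
      ((fun q x => q (π1 x)) '' G ∪ {mono l}) ((hGf.image _).union (finite_singleton _)) (by
        rintro q (⟨q, hq, rfl⟩ | rfl)
        · exact AnalyticAt.comp_of_eq (hG q hq) hR1.an hR1.zero
        · exact an_mono l (f := fun x => x) analyticAt_id)
    refine ⟨_, _, (hRR.comp hR2).comp hR3, fun j => ?_, fun q hq => ?_⟩
    · have h1 := (hG3 (mono l) (Or.inr rfl)).pow (D j)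
      refine (h1.mul (hM3 j)).congr ?_
      have h2 := (tendsto_of_an hR3.an hR3.zero).eventually
        ((tendsto_of_an hπ2 hπ20).eventually (hFe2 j))
      filter_upwards [h2] with p hp
      show F j (π1 (π3 p).1, mono l (π3 p).1 * (w0 + (π3 p).2)) = _
      rw [hp]
      simp only [hg, mul_add, Finset.mul_sum]
      congr 1
      · refine Finset.sum_congr rfl fun i _ => ?_
        have : mono l (π3 p).1 ^ D j = mono l (π3 p).1 ^ (D j - i) * mono l (π3 p).1 ^ (i : ℕ) := by
          rw [← pow_add, Nat.sub_add_cancel i.2.le]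
        rw [this, ← mul_add, mul_pow]; ring
      · rw [← mul_add, mul_pow]; ring
    · exact hG3 (fun x => q (π1 x)) (Or.inl ⟨q, hq, rfl⟩)
  · -- case A
    obtain ⟨π2, u2, hR2, hm1, hm2, q, hq, hq0, hqe⟩ := toric U l s z1 hR1.tends hz1t hzn ht
    have hπ2f : AnalyticAt ℝ (fun p => (π2 p).1) 0 := an_fst hR2.an
    have hπ2f0 : (π2 0).1 = 0 := by rw [hR2.zero]; rfl
    refine ⟨_, _, hRR.comp hR2, fun j => ?_, fun g hg => ?_⟩
    · right
      have hk : AnalyticAt ℝ (fun p => ∑ i : Fin (D j), q p ^ (D j - i) * b ⟨j, i⟩ (π2 p).1 +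
          h j (π1 (π2 p).1, (π2 p).2)) 0 := by
        refine AnalyticAt.add (Finset.analyticAt_fun_sum _ fun i _ => ?_) ?_
        · exact (hq.pow _).mul (AnalyticAt.comp_of_eq (hb ⟨j, i⟩) hπ2f hπ2f0)
        · exact AnalyticAt.comp_of_eq (g := fun p : (Fin m → ℝ) × ℝ => h j (π1 p.1, p.2)) (hH j) hR2.an hR2.zero
      refine ((hm2.pow (D j)).mul (Mon.unit _ hk ?_)).congr ?_
      · rw [Finset.sum_eq_zero, zero_add, hR2.zero]
        · exact hH0 j
        · intro i _
          rw [hq0, zero_pow (Nat.sub_pos_of_lt i.2).ne', zero_mul]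
      · have h2 := (tendsto_of_an hR2.an hR2.zero).eventually (hFe2 j)
        filter_upwards [h2, hqe] with p hp hp2
        show F j (π1 (π2 p).1, (π2 p).2) = _
        rw [hp, hp2, mul_add, Finset.mul_sum]
        congr 1
        refine Finset.sum_congr rfl fun i _ => ?_
        have : (π2 p).2 ^ D j = (π2 p).2 ^ (D j - i) * (π2 p).2 ^ (i : ℕ) := by
          rw [← pow_add, Nat.sub_add_cancel i.2.le]
        rw [this, mul_pow]; ring
    · exact (hG1 g hg).comp hπ2f hπ2f0 hm1

end LojGrad

namespace LojGrad

open Filter Topology Set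

theorem exists_dir {m : ℕ} (F : Set ((Fin m → ℝ) → ℝ)) (hF : F.Finite)
    (ha : ∀ f ∈ F, AnalyticAt ℝ f 0) (hn : ∀ f ∈ F, ¬ f =ᶠ[𝓝 0] 0) :
    ∃ v : Fin m → ℝ, ∀ f ∈ F, ¬ ∀ᶠ t in 𝓝 (0:ℝ), f (t • v) = 0 := by
  have h1 : ∀ᶠ x in 𝓝 (0 : Fin m → ℝ), ∀ f ∈ F, AnalyticAt ℝ f x :=
    (eventually_all_finite hF).2 fun f hf => (ha f hf).eventually_analyticAt
  obtain ⟨r, hr, hb⟩ := Metric.eventually_nhds_iff_ball.1 h1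
  have hpc : IsPreconnected (Metric.ball (0 : Fin m → ℝ) r) :=
    (convex_ball _ _).isPreconnected
  have key : ∀ F' : Set ((Fin m → ℝ) → ℝ), F'.Finite → F' ⊆ F →
      ∀ O : Set (Fin m → ℝ), IsOpen O → O.Nonempty → O ⊆ Metric.ball 0 r →
      ∃ v ∈ O, ∀ f ∈ F', f v ≠ 0 := by
    intro F' hF'
    induction F', hF' using Set.Finite.induction_on with
    | empty => exact fun _ O _ ⟨v, hv⟩ _ => ⟨v, hv, by simp⟩
    | @insert f F' _ _ ih =>
      intro hs O hO hne hOB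
      have hfF := hs (mem_insert _ _)
      have han : AnalyticOnNhd ℝ f (Metric.ball 0 r) := fun x hx => hb x hx f hfF
      obtain ⟨v, ⟨hvO, hv⟩, hv'⟩ := ih ((subset_insert _ _).trans hs) (O ∩ f ⁻¹' {0}ᶜ)
        ((han.continuousOn.mono hOB).isOpen_inter_preimage hO isOpen_compl_singleton) (by
          by_contra hemp
          rw [not_nonempty_iff_eq_empty] at hemp
          obtain ⟨x, hx⟩ := hne
          have hz : ∀ x ∈ O, f x = 0 := by
            intro x hx
            by_contra hfx
            have : x ∈ O ∩ f ⁻¹' {0}ᶜ := ⟨hx, hfx⟩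
            rw [hemp] at this
            exact this
          have h2 := han.eqOn_zero_of_preconnected_of_eventuallyEq_zero hpc (hOB hx)
            (by filter_upwards [hO.mem_nhds hx] with x hx using hz x hx)
          apply hn f hfF
          filter_upwards [Metric.ball_mem_nhds _ hr] with x hx using h2 hx)
        (inter_subset_left.trans hOB)
      refine ⟨v, hvO, ?_⟩
      rintro g (rfl | hg)
      · exact hv
      · exact hv' g hg
  obtain ⟨v, hv, hvf⟩ := key F hF subset_rfl _ Metric.isOpen_ball ⟨0, Metric.mem_ball_self hr⟩
    subset_rfl
  refine ⟨v, fun f hf hz => hvf f hf ?_⟩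
  have hlin : AnalyticOnNhd ℝ (fun t : ℝ => f (t • v)) {t : ℝ | t • v ∈ Metric.ball 0 r} := by
    intro t ht
    exact AnalyticAt.comp (g := f) (f := fun t : ℝ => t • v) (hb _ ht f hf) (by fun_prop)
  have hconv : Convex ℝ {t : ℝ | t • v ∈ Metric.ball 0 r} :=
    (convex_ball (0 : Fin m → ℝ) r).linear_preimage (LinearMap.toSpanSingleton ℝ _ v)
  have h2 := hlin.eqOn_zero_of_preconnected_of_eventuallyEq_zero hconv.isPreconnected
    (z₀ := 0) (by simpa using hr) hz
  have h3 : f ((1:ℝ) • v) = 0 := h2 (x := 1) (by simpa using hv)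
  simpa using h3

theorem uni_zero {ι : Type} (U : Ultrafilter ι) : Uni U 0 := by
  intro y hy F _ hF
  refine ⟨fun x => x, y, ⟨analyticAt_id, rfl, hy, Eventually.of_forall fun _ => rfl⟩, ?_⟩
  intro f hf
  by_cases h0 : f 0 = 0
  · left
    exact Eventually.of_forall fun x => by rw [Subsingleton.elim x 0]; exact h0
  · exact Or.inr (Mon.unit _ (hF f hf) h0)

theorem uni_succ {ι : Type} {U : Ultrafilter ι} {m : ℕ} (hU : Uni U m) : Uni U (m + 1) := by
  intro y hy F hFf hF
  set F' : Set ((Fin (m + 1) → ℝ) → ℝ) := {f ∈ F | ¬ f =ᶠ[𝓝 0] 0} ∪ {fun x => x 0} with hF'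
  have hF'f : F'.Finite := (hFf.subset (sep_subset _ _)).union (finite_singleton _)
  have hF'a : ∀ f ∈ F', AnalyticAt ℝ f 0 := by
    rintro f (hf | rfl)
    · exact hF f hf.1
    · fun_prop
  obtain ⟨v, hv⟩ := exists_dir F' hF'f hF'a (by
    rintro f (hf | rfl)
    · exact hf.2
    · intro h
      apply mono_not_zero [(0 : Fin (m + 1))]
      filter_upwards [h] with x hx
      simpa [mono] using hx)
  have hv0 : v 0 ≠ 0 := by
    intro h
    refine hv (fun x => x 0) (Or.inr rfl) (Eventually.of_forall fun t => ?_)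
    simp [h]
  set T : (Fin m → ℝ) × ℝ → (Fin (m + 1) → ℝ) := fun p =>
    Fin.cons (p.2 * v 0) (fun i => p.1 i + p.2 * v i.succ) with hT
  have hTa : AnalyticAt ℝ T 0 := by
    refine an_pi fun i => ?_
    refine Fin.cases ?_ (fun i => ?_) i
    · simp only [hT, Fin.cons_zero]; fun_prop
    · simp only [hT, Fin.cons_succ]; fun_prop
  have hT0 : T 0 = 0 := by
    funext i
    refine Fin.cases ?_ (fun i => ?_) i <;> simp [hT]
  have hyi : ∀ i, Tendsto (fun n => y n i) U (𝓝 0) := fun i => by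
    simpa using (tendsto_pi_nhds.1 hy) i
  set z1 : ι → ℝ := fun n => y n 0 / v 0 with hz1
  set y1 : ι → (Fin m → ℝ) := fun n i => y n i.succ - z1 n * v i.succ with hy1
  have hz1t : Tendsto z1 U (𝓝 0) := by
    have := (hyi 0).div_const (v 0); simpa using this
  have hy1t : Tendsto y1 U (𝓝 0) := by
    refine tendsto_pi_nhds.2 fun i => ?_
    have := (hyi i.succ).sub (hz1t.mul_const (v i.succ)); simpa using this
  have hR0 : Ref U y T (fun n => (y1 n, z1 n)) := by
    refine ⟨hTa, hT0, hy1t.prodMk_nhds hz1t, Eventually.of_forall fun n => ?_⟩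
    funext i
    refine Fin.cases ?_ (fun i => ?_) i
    · simp [hT, hz1, hv0]
    · simp [hT, hy1]
  have hfT : ∀ f ∈ F', AnalyticAt ℝ (fun p => f (T p)) 0 := fun f hf =>
    AnalyticAt.comp_of_eq (hF'a f hf) hTa hT0
  have hTl : ∀ t : ℝ, T (0, t) = t • v := by
    intro t
    funext i
    refine Fin.cases ?_ (fun i => ?_) i <;> simp [hT]
  have hreg : ∀ f : F', ∃ D, Reg (fun p => f.1 (T p)) D := by
    intro f
    have h1 : AnalyticAt ℝ (fun t : ℝ => f.1 (t • v)) 0 :=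
      AnalyticAt.comp_of_eq (g := f.1) (f := fun t : ℝ => t • v) (hF'a f f.2) (by fun_prop)
        (by simp)
    have h2 : analyticOrderAt (fun t : ℝ => f.1 (t • v)) 0 ≠ ⊤ := by
      rw [Ne, analyticOrderAt_eq_top]
      exact hv f f.2
    obtain ⟨D, hD⟩ := ENat.ne_top_iff_exists.1 h2
    obtain ⟨u, hu, hu0, hue⟩ := h1.analyticOrderAt_eq_natCast.1 hD.symm
    refine ⟨D, u, hu, hu0, ?_⟩
    filter_upwards [hue] with t ht
    rw [hTl, ht]; simp
  choose D hD using hreg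
  have : Fintype F' := hF'f.fintype
  obtain ⟨π, u, hR, hM, _⟩ := Rind hU _ y1 z1 hy1t hz1t F' (fun f p => f.1 (T p)) D
    (fun f => hfT f f.2) hD rfl ∅ finite_empty (by simp)
  set S : (Fin (m + 1) → ℝ) → (Fin m → ℝ) × ℝ := fun x => (fun i => x i.succ, x 0) with hS
  have hSa : AnalyticAt ℝ S 0 := by
    refine AnalyticAt.prod (an_pi fun i => ?_) ?_ <;> fun_prop
  have hut := hR.tends
  rw [show (0 : (Fin m → ℝ) × ℝ) = (0, 0) from rfl, nhds_prod_eq] at hut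
  have hR2 : Ref U u S (fun n => Fin.cons (u n).2 (u n).1) := by
    refine ⟨hSa, rfl, ?_, Eventually.of_forall fun n => by simp [hS]⟩
    refine tendsto_pi_nhds.2 fun i => ?_
    refine Fin.cases ?_ (fun i => ?_) i
    · exact tendsto_snd.comp hut
    · simpa using (tendsto_pi_nhds.1 (tendsto_fst.comp hut)) i
  refine ⟨_, _, (hR0.comp hR).comp hR2, fun f hf => ?_⟩
  by_cases hz : f =ᶠ[𝓝 0] 0
  · left
    exact (tendsto_of_an ((hR0.comp hR).comp hR2).an ((hR0.comp hR).comp hR2).zero).eventually hz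
  · have h1 := hM ⟨f, Or.inl ⟨hf, hz⟩⟩
    refine h1.comp (c' := cF (m + 1)) hSa rfl ?_
    intro o
    cases o with
    | none => exact Mon.coord (cF (m + 1)) 0
    | some i => exact Mon.coord (cF (m + 1)) i.succ

theorem uni {ι : Type} (U : Ultrafilter ι) (m : ℕ) : Uni U m := by
  induction m with
  | zero => exact uni_zero U
  | succ m ih => exact uni_succ ih

end LojGrad

namespace LojGrad

open Filter Topology Set

theorem euler {m : ℕ} {f : (Fin m → ℝ) → ℝ} (hf : Mon (cF m) f) :
    ∃ k : ℕ, (k = 0 → f 0 ≠ 0) ∧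
      ∀ᶠ x in 𝓝 (0 : Fin m → ℝ), |fderiv ℝ f x x - k * f x| ≤ 1 / 2 * |f x| := by
  obtain ⟨α, h, hh, h0, e⟩ := hf
  refine ⟨∑ i, α i, ?_, ?_⟩
  · intro hk
    have h1 : ∀ i, α i = 0 := by simpa using hk
    rw [e.self_of_nhds]
    simpa [h1] using h0
  have hd0 : ContinuousAt (fun x => (1 / 2 : ℝ) * |h x|) 0 := by
    have := hh.continuousAt; fun_prop
  have hd1 : ContinuousAt (fun x => |fderiv ℝ h x x|) 0 :=
    (hh.fderiv.continuousAt.clm_apply continuousAt_id).abs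
  have hlt := hd1.eventually_lt hd0 (by simpa using h0)
  filter_upwards [hlt, e, hh.eventually_analyticAt, e.fderiv (𝕜 := ℝ)] with x h1 h2 h3 h4
  set F : (Fin m → ℝ) → ℝ := fun x => (∏ i, cF m i x ^ α i) * h x with hF
  set Q : ℝ := ∏ i, cF m i x ^ α i with hQ
  have hFd : DifferentiableAt ℝ F x := by
    refine DifferentiableAt.mul ?_ h3.differentiableAt
    simp only [cF]
    fun_prop
  have hlin : HasDerivAt (fun t : ℝ => t • x) x 1 := by
    simpa using (hasDerivAt_id (1:ℝ)).smul_const x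
  have d1 : HasDerivAt (fun t : ℝ => F (t • x)) (fderiv ℝ F x x) 1 :=
    HasFDerivAt.comp_hasDerivAt (l := F) (f := fun t : ℝ => t • x) (1:ℝ)
      (by simpa using hFd.hasFDerivAt) hlin
  have d2 : HasDerivAt (fun t : ℝ => h (t • x)) (fderiv ℝ h x x) 1 :=
    HasFDerivAt.comp_hasDerivAt (l := h) (f := fun t : ℝ => t • x) (1:ℝ)
      (by simpa using h3.differentiableAt.hasFDerivAt) hlin
  have d3 : HasDerivAt (fun t : ℝ => t ^ (∑ i, α i) * Q * h (t • x))
      ((∑ i, α i : ℕ) * Q * h x + Q * fderiv ℝ h x x) 1 := by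
    have := ((hasDerivAt_pow (∑ i, α i) (1:ℝ)).mul_const Q).mul d2
    refine HasDerivAt.congr_deriv this ?_
    simp
  have heq : (fun t : ℝ => F (t • x)) = fun t : ℝ => t ^ (∑ i, α i) * Q * h (t • x) := by
    funext t
    simp only [hF, hQ, cF, Pi.smul_apply, smul_eq_mul, mul_pow, Finset.prod_mul_distrib,
      Finset.prod_pow_eq_pow_sum]
  rw [heq] at d1
  have d4 := d1.unique d3
  rw [h4, h2, d4]
  have : (∑ i, α i : ℕ) * Q * h x + Q * fderiv ℝ h x x - (∑ i, α i : ℕ) * (Q * h x)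
      = Q * fderiv ℝ h x x := by ring
  rw [this, abs_mul, abs_mul]
  nlinarith [abs_nonneg Q]

theorem euler_le {m : ℕ} {f : (Fin m → ℝ) → ℝ} (hf : MonZ (cF m) f) :
    ∃ C : ℝ, 0 ≤ C ∧ ∀ᶠ x in 𝓝 (0 : Fin m → ℝ), |fderiv ℝ f x x| ≤ C * |f x| := by
  rcases hf with hf | hf
  · refine ⟨0, le_rfl, ?_⟩
    filter_upwards [hf.fderiv (𝕜 := ℝ)] with x hx
    rw [hx]
    simp
  · obtain ⟨k, _, hk⟩ := euler hf
    refine ⟨k + 1 / 2, by positivity, ?_⟩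
    filter_upwards [hk] with x hx
    have h1 := abs_add_le (fderiv ℝ f x x - k * f x) (k * f x)
    rw [sub_add_cancel, abs_mul, Nat.abs_cast] at h1
    linarith

theorem euler_ge {m : ℕ} {f : (Fin m → ℝ) → ℝ} (hf : MonZ (cF m) f) (h0 : f 0 = 0) :
    ∀ᶠ x in 𝓝 (0 : Fin m → ℝ), |f x| ≤ 2 * |fderiv ℝ f x x| := by
  rcases hf with hf | hf
  · filter_upwards [hf] with x hx
    rw [hx]
    simp
  · obtain ⟨k, hk0, hk⟩ := euler hf
    have hk1 : (1:ℝ) ≤ k := by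
      have : k ≠ 0 := fun h => hk0 h h0
      exact_mod_cast Nat.one_le_iff_ne_zero.2 this
    filter_upwards [hk] with x hx
    have h1 := abs_sub_le (k * f x) (fderiv ℝ f x x) 0
    rw [sub_zero, sub_zero, abs_mul, Nat.abs_cast, abs_sub_comm] at h1
    nlinarith [abs_nonneg (f x)]

theorem grad_seq {ι : Type} (U : Ultrafilter ι) {m : ℕ} {g : (Fin m → ℝ) → ℝ}
    (hg : AnalyticAt ℝ g 0) (hg0 : g 0 = 0) {y : ι → (Fin m → ℝ)} (hy : Tendsto y U (𝓝 0)) :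
    ∃ C : ℝ, 0 ≤ C ∧ ∀ᶠ n in (U : Filter ι),
      |g (y n)| ≤ C * ∑ j, |y n j| * |fderiv ℝ g (y n) (Pi.single j 1)| := by
  obtain ⟨π, u, hR, hM⟩ := uni U m y hy ({g} ∪ range (fun (j : Fin m) (x : Fin m → ℝ) => x j))
    ((finite_singleton _).union (finite_range _)) (by
      rintro f (rfl | ⟨j, rfl⟩)
      · exact hg
      · fun_prop)
  have h1 := euler_ge (hM g (Or.inl rfl)) (by rw [hR.zero, hg0])
  choose C hC0 hC using fun j : Fin m => euler_le (hM (fun x => x j) (Or.inr ⟨j, rfl⟩))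
  have hC' := eventually_all.2 hC
  refine ⟨2 * ∑ j, C j, by
    have := Finset.sum_nonneg fun j (_ : j ∈ Finset.univ) => hC0 j
    positivity, ?_⟩
  have hπa := hR.an.eventually_analyticAt
  have hga := (tendsto_of_an hR.an hR.zero).eventually hg.eventually_analyticAt
  have hall := hR.tends.eventually (((h1.and hC').and hπa).and hga)
  filter_upwards [hall, hR.eq] with n hn hyn
  obtain ⟨⟨⟨k1, k2⟩, k3⟩, k4⟩ := hn
  rw [hyn]
  set x := u n
  have hch : fderiv ℝ (fun x => g (π x)) x x = fderiv ℝ g (π x) (fderiv ℝ π x x) := by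
    have := fderiv_comp (g := g) (f := π) x k4.differentiableAt k3.differentiableAt
    have h2 : (fun x => g (π x)) = g ∘ π := rfl
    rw [h2, this]; rfl
  have hξ : ∀ j, fderiv ℝ π x x j = fderiv ℝ (fun x => π x j) x x := by
    intro j
    rw [fderiv_apply k3.differentiableAt]; rfl
  have hsum : fderiv ℝ g (π x) (fderiv ℝ π x x) =
      ∑ j, fderiv ℝ π x x j * fderiv ℝ g (π x) (Pi.single j 1) := by
    have h2 := LinearMap.pi_apply_eq_sum_univ (fderiv ℝ g (π x)).toLinearMap (fderiv ℝ π x x)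
    simp only [ContinuousLinearMap.coe_coe, smul_eq_mul] at h2
    rw [h2]
    refine Finset.sum_congr rfl fun j _ => ?_
    congr 2
    funext i
    simp [Pi.single_apply, eq_comm]
  refine k1.trans ?_
  rw [hch, hsum, mul_assoc]
  refine mul_le_mul_of_nonneg_left ?_ zero_le_two
  refine (Finset.abs_sum_le_sum_abs _ _).trans ?_
  rw [Finset.mul_sum]
  refine Finset.sum_le_sum fun j _ => ?_
  rw [abs_mul, hξ, ← mul_assoc]
  refine mul_le_mul_of_nonneg_right ((k2 j).trans ?_) (abs_nonneg _)
  refine mul_le_mul_of_nonneg_right ?_ (abs_nonneg _)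
  exact Finset.single_le_sum (fun i _ => hC0 i) (Finset.mem_univ j)

end LojGrad

/-- Łojasiewicz-type gradient inequality: if `f` is real analytic near `0`
in `ℝ^m` with `f(0) = 0`, then `|f(x)| ≤ C·|x|·|∇f(x)|` on some neighbourhood `V` of `0`. -/
theorem analytic_gradient_inequality
    (m : ℕ) (U : Set (EuclideanSpace ℝ (Fin m))) (hU : IsOpen U)
    (h0 : (0 : EuclideanSpace ℝ (Fin m)) ∈ U)
    (f : EuclideanSpace ℝ (Fin m) → ℝ) (hf : AnalyticOnNhd ℝ f U)
    (hf0 : f 0 = 0) :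
    ∃ (V : Set (EuclideanSpace ℝ (Fin m))) (C : ℝ),
      IsOpen V ∧ (0 : EuclideanSpace ℝ (Fin m)) ∈ V ∧ V ⊆ U ∧ 0 ≤ C ∧
      ∀ x ∈ V,
        |f x| ≤ C * Real.sqrt (∑ i, x i ^ 2) *
          Real.sqrt (∑ i, (fderivWithin ℝ f U x (EuclideanSpace.single i (1:ℝ))) ^ 2) := by
  by_contra hcon
  have hbad : ∀ n : ℕ, ∃ x ∈ Metric.ball (0 : EuclideanSpace ℝ (Fin m)) (1 / ((n:ℝ) + 1)) ∩ U,
      (n : ℝ) * Real.sqrt (∑ i, x i ^ 2) *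
          Real.sqrt (∑ i, (fderivWithin ℝ f U x (EuclideanSpace.single i (1:ℝ))) ^ 2) < |f x| := by
    intro n
    by_contra h
    push Not at h
    exact hcon ⟨_, n, Metric.isOpen_ball.inter hU,
      ⟨Metric.mem_ball_self (by positivity), h0⟩, Set.inter_subset_right, n.cast_nonneg, h⟩
  choose x hx hlt using hbad
  have hxt : Filter.Tendsto x (Filter.hyperfilter ℕ : Filter ℕ) (nhds 0) := by
    refine Filter.Tendsto.mono_left ?_ Nat.hyperfilter_le_atTop
    rw [tendsto_iff_dist_tendsto_zero]
    exact squeeze_zero (fun _ => dist_nonneg) (fun n => (Metric.mem_ball.1 (hx n).1).le)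
      tendsto_one_div_add_atTop_nhds_zero_nat
  let e := EuclideanSpace.equiv (Fin m) ℝ
  have hga : AnalyticAt ℝ (fun z : Fin m → ℝ => f (e.symm z)) 0 :=
    AnalyticAt.comp_of_eq (g := f) (f := fun z : Fin m → ℝ => e.symm z) (hf 0 h0)
      (e.symm.toContinuousLinearMap.analyticAt 0) (map_zero e.symm)
  have hyt : Filter.Tendsto (fun n => e (x n)) (Filter.hyperfilter ℕ : Filter ℕ) (nhds 0) := by
    have := (e.continuous.tendsto 0).comp hxt
    rwa [map_zero] at this
  obtain ⟨C, hC0, hC⟩ := LojGrad.grad_seq (Filter.hyperfilter ℕ) hga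
    (by rw [map_zero, hf0]) hyt
  have hge : ∀ᶠ n : ℕ in (Filter.hyperfilter ℕ : Filter ℕ), C ≤ n :=
    Nat.hyperfilter_le_atTop (tendsto_natCast_atTop_atTop.eventually_ge_atTop C)
  obtain ⟨n, hn1, hn2⟩ := (hC.and hge).exists
  have hxU := (hx n).2
  have hd : ∀ j, fderiv ℝ (fun z : Fin m → ℝ => f (e.symm z)) (e (x n)) (Pi.single j 1) =
      fderivWithin ℝ f U (x n) (EuclideanSpace.single j (1:ℝ)) := by
    intro j
    rw [fderivWithin_of_isOpen hU hxU]
    have h1 : HasFDerivAt f (fderiv ℝ f (x n)) (e.symm (e (x n))) := by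
      rw [e.symm_apply_apply]; exact (hf _ hxU).differentiableAt.hasFDerivAt
    have h2 := h1.comp (e (x n)) e.symm.hasFDerivAt
    have h3 : fderiv ℝ (fun z : Fin m → ℝ => f (e.symm z)) (e (x n)) = _ := h2.fderiv
    rw [h3]
    rfl
  rw [e.symm_apply_apply] at hn1
  simp only [hd] at hn1
  have hcs := Real.sum_mul_le_sqrt_mul_sqrt Finset.univ (fun j => |e (x n) j|)
    (fun j => |fderivWithin ℝ f U (x n) (EuclideanSpace.single j (1:ℝ))|)
  simp only [sq_abs] at hcs
  have hcs' : ∑ j, |e (x n) j| * |fderivWithin ℝ f U (x n) (EuclideanSpace.single j (1:ℝ))| ≤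
      Real.sqrt (∑ i, x n i ^ 2) *
        Real.sqrt (∑ i, (fderivWithin ℝ f U (x n) (EuclideanSpace.single i (1:ℝ))) ^ 2) := hcs
  have hfin := (hlt n).trans_le (hn1.trans (mul_le_mul hn2 hcs'
    (Finset.sum_nonneg fun j _ => by positivity) n.cast_nonneg))
  rw [mul_assoc] at hfin
  exact lt_irrefl _ hfin
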